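/- For every T > 0 and every f ∈ C_c^∞(ℂⁿ×ℝ), one has ∫_{ℂⁿ×ℝ} |P_{>T} f − S_n(P_{>T} f)|² dσ ≤ (2/T) ∫_{ℂⁿ×ℝ} ( Σ_{j=1}^n |L̄_j f|² ) dσ. -/

import Mathlib

open MeasureTheory Complex Filter
open scoped ContDiff ENNReal

noncomputable section

abbrev Hgrp (n : ℕ) := (Fin n → ℂ) × ℝ

def nsq {n : ℕ} (z : Fin n → ℂ) : ℝ := ∑ j, Complex.normSq (z j)

def dZ {n : ℕ} (j : Fin n) (f : Hgrp n → ℂ) : Hgrp n → ℂ := fun p =>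
  (1/2 : ℂ) * (fderiv ℝ f p (Pi.single j 1, 0) - Complex.I * fderiv ℝ f p (Pi.single j Complex.I, 0))

def dZbar {n : ℕ} (j : Fin n) (f : Hgrp n → ℂ) : Hgrp n → ℂ := fun p =>
  (1/2 : ℂ) * (fderiv ℝ f p (Pi.single j 1, 0) + Complex.I * fderiv ℝ f p (Pi.single j Complex.I, 0))

def dT {n : ℕ} (f : Hgrp n → ℂ) : Hgrp n → ℂ := fun p => fderiv ℝ f p (0, 1)

def Lop {n : ℕ} (j : Fin n) (f : Hgrp n → ℂ) : Hgrp n → ℂ := fun p =>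
  dZ j f p + Complex.I * (starRingEnd ℂ) (p.1 j) * dT f p

def Lbar {n : ℕ} (j : Fin n) (f : Hgrp n → ℂ) : Hgrp n → ℂ := fun p =>
  dZbar j f p - Complex.I * (p.1 j) * dT f p

/-- `f` is CR in the sense of distributions. -/
def IsCRfun {n : ℕ} (f : Hgrp n → ℂ) : Prop :=
  ∀ j : Fin n, ∀ φ : Hgrp n → ℂ, ContDiff ℝ ∞ φ → HasCompactSupport φ →
    ∫ p : Hgrp n, f p * Lbar j φ p = 0

def pFourier {n : ℕ} (f : Hgrp n → ℂ) (z : Fin n → ℂ) (ξ : ℝ) : ℂ :=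
  (Real.sqrt (2 * Real.pi))⁻¹ • ∫ t : ℝ, f (z, t) * Complex.exp (-Complex.I * ξ * t)

/-- The unitary Fourier transform on the real line, normalised as in `pFourier`. -/
def unitaryFourier (u : ℝ → ℂ) (ξ : ℝ) : ℂ :=
  (Real.sqrt (2 * Real.pi))⁻¹ • ∫ t : ℝ, u t * Complex.exp (-Complex.I * ξ * t)

lemma unitaryFourier_eq (u : ℝ → ℂ) (ξ : ℝ) :
    unitaryFourier u ξ =
      (Real.sqrt (2 * Real.pi))⁻¹ • FourierTransform.fourier u ((2 * Real.pi)⁻¹ * ξ) := by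
  rw [unitaryFourier, Real.fourier_real_eq_integral_exp_smul]
  congr 2
  ext t
  rw [smul_eq_mul, mul_comm]
  congr 2
  have : (Real.pi : ℂ) ≠ 0 := by exact_mod_cast Real.pi_ne_zero
  push_cast
  field_simp

lemma integral_fourier_schwartz_smul (G : SchwartzMap ℝ ℂ) {u : ℝ → ℂ} (h1 : Integrable u) :
    ∫ x, (FourierTransform.fourier G) x • u x = ∫ x, G x • FourierTransform.fourier u x := by
  have e3 := VectorFourier.integral_fourierIntegral_smul_eq_flip (L := innerₗ ℝ)
    (f := ⇑G) (g := u) (μ := volume) (ν := volume)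
    Real.continuous_fourierChar continuous_inner G.integrable h1
  rw [flip_innerₗ] at e3
  rw [SchwartzMap.fourier_coe]
  exact e3

lemma integral_schwartz_smul_fourier_toLp (G : SchwartzMap ℝ ℂ) {u : ℝ → ℂ} (h1 : Integrable u)
    (h2 : MemLp u 2) :
    ∫ x, G x • (FourierTransform.fourier (h2.toLp u) : Lp ℂ 2 (volume : Measure ℝ)) x =
      ∫ x, G x • FourierTransform.fourier u x := by
  have e1 := Lp.toTemperedDistribution_apply
    (FourierTransform.fourier (h2.toLp u) : Lp ℂ 2 (volume : Measure ℝ)) G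
  rw [← Lp.fourier_toTemperedDistribution_eq, TemperedDistribution.fourier_apply,
    Lp.toTemperedDistribution_apply] at e1
  rw [← e1, ← integral_fourier_schwartz_smul G h1]
  refine integral_congr_ae ?_
  filter_upwards [h2.coeFn_toLp] with x hx
  rw [hx]

lemma ae_eq_of_integral_schwartz_smul_eq {v k : ℝ → ℂ} (hv : LocallyIntegrable v)
    (hk : LocallyIntegrable k) (h : ∀ G : SchwartzMap ℝ ℂ, ∫ x, G x • v x = ∫ x, G x • k x) :
    v =ᵐ[volume] k := by
  refine ae_eq_of_integral_contDiff_smul_eq hv hk ?_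
  intro g hg hgc
  have hg' : ContDiff ℝ ∞ (fun x => (g x : ℂ)) :=
    Complex.ofRealCLM.contDiff.comp hg
  have hgc' : HasCompactSupport (fun x => (g x : ℂ)) := 
    hgc.comp_left (g := fun x : ℝ => (x : ℂ)) Complex.ofReal_zero
  have e := h (hgc'.toSchwartzMap hg')
  have hG : ∀ x : ℝ, (hgc'.toSchwartzMap hg') x = (g x : ℂ) := fun x => rfl
  simp only [hG, smul_eq_mul] at e
  simp only [Complex.real_smul]
  exact e

lemma fourier_toLp_ae_eq {u : ℝ → ℂ} (h1 : Integrable u) (h2 : MemLp u 2) :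
    (FourierTransform.fourier (h2.toLp u) : Lp ℂ 2 (volume : Measure ℝ)) =ᵐ[volume]
      FourierTransform.fourier u :=
  ae_eq_of_integral_schwartz_smul_eq ((Lp.memLp _).locallyIntegrable (by norm_num))
    (VectorFourier.fourierIntegral_continuous Real.continuous_fourierChar
      continuous_inner h1).locallyIntegrable
    fun G => integral_schwartz_smul_fourier_toLp G h1 h2

lemma lintegral_enorm_fourier_sq {u : ℝ → ℂ} (h1 : Integrable u) (h2 : MemLp u 2) :
    ∫⁻ ξ, ‖FourierTransform.fourier u ξ‖ₑ ^ 2 = ∫⁻ t, ‖u t‖ₑ ^ 2 := by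
  have key : ∀ v : Lp ℂ 2 (volume : Measure ℝ), ∫⁻ x, ‖v x‖ₑ ^ 2 = ‖v‖ₑ ^ 2 := by
    intro v
    rw [Lp.enorm_def, eLpNorm_eq_lintegral_rpow_enorm_toReal (by norm_num) (by norm_num)]
    simp only [ENNReal.toReal_ofNat, ENNReal.rpow_ofNat]
    rw [← ENNReal.rpow_ofNat, ← ENNReal.rpow_mul]
    norm_num
  have e := key (FourierTransform.fourier (h2.toLp u))
  have hn : ‖(FourierTransform.fourier (h2.toLp u) : Lp ℂ 2 (volume : Measure ℝ))‖ₑ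
      = ‖h2.toLp u‖ₑ := by
    rw [← ofReal_norm, ← ofReal_norm, Lp.norm_fourier_eq]
  rw [hn, ← key] at e
  calc _ = ∫⁻ x, ‖(FourierTransform.fourier (h2.toLp u) : Lp ℂ 2 (volume : Measure ℝ)) x‖ₑ ^ 2 := by
        refine lintegral_congr_ae ?_
        filter_upwards [fourier_toLp_ae_eq h1 h2] with x hx
        rw [hx]
    _ = _ := e
    _ = _ := by
        refine lintegral_congr_ae ?_
        filter_upwards [h2.coeFn_toLp] with x hx
        rw [hx]

lemma lintegral_enorm_unitaryFourier_sq {u : ℝ → ℂ} (h1 : Integrable u) (h2 : MemLp u 2) :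
    ∫⁻ ξ, ‖unitaryFourier u ξ‖ₑ ^ 2 = ∫⁻ t, ‖u t‖ₑ ^ 2 := by
  have hpi : 0 < 2 * Real.pi := by positivity
  have hcont : Continuous (FourierTransform.fourier u) :=
    VectorFourier.fourierIntegral_continuous Real.continuous_fourierChar continuous_inner h1
  have hne : (2 * Real.pi)⁻¹ ≠ 0 := by positivity
  have hs : ‖(Real.sqrt (2 * Real.pi))⁻¹‖ₑ ^ 2 = ENNReal.ofReal (2 * Real.pi)⁻¹ := by
    rw [Real.enorm_eq_ofReal (by positivity), ← ENNReal.ofReal_pow (by positivity), inv_pow,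
      Real.sq_sqrt hpi.le]
  simp_rw [unitaryFourier_eq, enorm_smul, mul_pow, hs]
  have hm : Measurable fun ξ => ‖FourierTransform.fourier u ξ‖ₑ ^ 2 := by fun_prop
  have hm' : Measurable fun ξ => ‖FourierTransform.fourier u ((2 * Real.pi)⁻¹ * ξ)‖ₑ ^ 2 :=
    hm.comp (measurable_const_mul _)
  rw [lintegral_const_mul _ hm',
    ← lintegral_map (f := fun ξ => ‖FourierTransform.fourier u ξ‖ₑ ^ 2) hm (measurable_const_mul _),
    Real.map_volume_mul_left hne, lintegral_smul_measure, inv_inv, abs_of_pos hpi, smul_eq_mul,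
    ← mul_assoc, ← ENNReal.ofReal_mul (by positivity), inv_mul_cancel₀ hpi.ne',
    ENNReal.ofReal_one, one_mul, lintegral_enorm_fourier_sq h1 h2]

/-- Plancherel inequality for the inverse transform of an integrable, square-integrable function. -/
lemma lintegral_enorm_inverse_sq {u : ℝ → ℂ} (h1 : Integrable u) (h2 : MemLp u 2) :
    ∫⁻ t : ℝ, ‖(Real.sqrt (2 * Real.pi))⁻¹ • ∫ ξ : ℝ, u ξ * Complex.exp (Complex.I * ξ * t)‖ₑ ^ 2
      = ∫⁻ ξ, ‖u ξ‖ₑ ^ 2 := by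
  rw [← lintegral_enorm_unitaryFourier_sq h1 h2,
    ← lintegral_neg_eq_self (fun ξ => ‖unitaryFourier u ξ‖ₑ ^ 2)]
  refine lintegral_congr fun t => ?_
  rw [unitaryFourier]
  congr 4
  ext ξ
  push_cast
  ring_nf

lemma unitaryFourier_inversion {u : ℝ → ℂ} (hc : Continuous u) (h1 : Integrable u)
    (h2 : Integrable (unitaryFourier u)) (t : ℝ) :
    u t = (Real.sqrt (2 * Real.pi))⁻¹ •
      ∫ ξ : ℝ, unitaryFourier u ξ * Complex.exp (Complex.I * ξ * t) := by
  have hpi : 0 < 2 * Real.pi := by positivity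
  have hs : 0 < Real.sqrt (2 * Real.pi) := Real.sqrt_pos.2 hpi
  have e0 : ∀ ξ, FourierTransform.fourier u ξ
      = Real.sqrt (2 * Real.pi) • unitaryFourier u ((2 * Real.pi) * ξ) := by
    intro ξ
    rw [unitaryFourier_eq, smul_smul, mul_inv_cancel₀ hs.ne', one_smul, ← mul_assoc,
      inv_mul_cancel₀ hpi.ne', one_mul]
  have hint : Integrable (FourierTransform.fourier u) := by
    rw [show FourierTransform.fourier u = fun ξ => _ from funext e0]
    exact (h2.comp_mul_left' hpi.ne').smul (Real.sqrt (2 * Real.pi))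
  have e1 := congrFun (hc.fourierInv_fourier_eq h1 hint) t
  rw [Real.fourierInv_eq'] at e1
  rw [← e1]
  have e2 := Measure.integral_comp_mul_left
    (fun ξ : ℝ => unitaryFourier u ξ * Complex.exp (Complex.I * ξ * t)) (2 * Real.pi)
  have e3 : ∀ v : ℝ, Complex.exp (↑(2 * Real.pi * inner ℝ v t) * Complex.I) •
      FourierTransform.fourier u v = Real.sqrt (2 * Real.pi) •
        (unitaryFourier u (2 * Real.pi * v) *
          Complex.exp (Complex.I * ((2 * Real.pi * v : ℝ) : ℂ) * t)) := by
    intro v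
    have : ((2 * Real.pi * inner ℝ v t : ℝ) : ℂ) * Complex.I
        = Complex.I * ((2 * Real.pi * v : ℝ) : ℂ) * t := by
      simp only [RCLike.inner_apply, conj_trivial]
      push_cast
      ring
    rw [e0, this, smul_comm, smul_eq_mul, mul_comm (Complex.exp _)]
  simp_rw [e3]
  rw [integral_smul, e2, smul_smul, abs_of_pos (inv_pos.2 hpi)]
  congr 1
  have := Real.sq_sqrt hpi.le
  field_simp
  exact this

section Smoothness

variable {n : ℕ}

lemma contDiff_fderiv_apply_const {f : Hgrp n → ℂ} (hf : ContDiff ℝ ∞ f) (v : Hgrp n) :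
    ContDiff ℝ ∞ fun p => fderiv ℝ f p v :=
  (hf.fderiv_right (m := ∞) (by simp)).clm_apply contDiff_const

lemma hasCompactSupport_fderiv_apply_const {f : Hgrp n → ℂ} (hf : HasCompactSupport f)
    (v : Hgrp n) : HasCompactSupport fun p => fderiv ℝ f p v :=
  hf.fderiv_apply ℝ v

lemma contDiff_fst_apply (j : Fin n) : ContDiff ℝ ∞ fun p : Hgrp n => p.1 j :=
  (contDiff_apply ℝ ℂ j).comp contDiff_fst

lemma contDiff_Lbar {f : Hgrp n → ℂ} (hf : ContDiff ℝ ∞ f) (j : Fin n) :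
    ContDiff ℝ ∞ (Lbar j f) :=
  (contDiff_const.mul ((contDiff_fderiv_apply_const hf _).add
    (contDiff_const.mul (contDiff_fderiv_apply_const hf _)))).sub
    ((contDiff_const.mul (contDiff_fst_apply j)).mul (contDiff_fderiv_apply_const hf _))

lemma hasCompactSupport_Lbar {f : Hgrp n → ℂ} (hf : HasCompactSupport f) (j : Fin n) :
    HasCompactSupport (Lbar j f) := by
  have h : HasCompactSupport (fderiv ℝ f) := hf.fderiv ℝ
  refine h.mono fun p hp => ?_
  contrapose! hp
  have h0 : fderiv ℝ f p = 0 := by simpa using hp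
  simp [Lbar, dZbar, dT, h0]

lemma contDiff_dT {f : Hgrp n → ℂ} (hf : ContDiff ℝ ∞ f) : ContDiff ℝ ∞ (dT f) :=
  contDiff_fderiv_apply_const hf _

lemma hasCompactSupport_dT {f : Hgrp n → ℂ} (hf : HasCompactSupport f) :
    HasCompactSupport (dT f) :=
  hasCompactSupport_fderiv_apply_const hf _

lemma integral_mul_fderiv_eq_neg {u v : Hgrp n → ℂ} (hu : ContDiff ℝ ∞ u)
    (hv : ContDiff ℝ ∞ v) (huc : HasCompactSupport u) (w : Hgrp n) :
    ∫ p, u p * fderiv ℝ v p w = - ∫ p, fderiv ℝ u p w * v p := by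
  have hu' := (contDiff_fderiv_apply_const hu w).continuous
  have hv' := (contDiff_fderiv_apply_const hv w).continuous
  have : (volume : Measure (Hgrp n)).IsAddHaarMeasure :=
    Measure.prod.instIsAddHaarMeasure _ _
  refine integral_mul_fderiv_eq_neg_fderiv_mul_of_integrable ?_ ?_ ?_
    (fun x _ => hu.differentiable (by simp) x) (fun x _ => hv.differentiable (by simp) x)
  · exact (hu'.mul hv.continuous).integrable_of_hasCompactSupport
      (hasCompactSupport_fderiv_apply_const huc w).mul_right
  · exact (hu.continuous.mul hv').integrable_of_hasCompactSupport huc.mul_right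
  · exact (hu.continuous.mul hv.continuous).integrable_of_hasCompactSupport huc.mul_right

lemma fderiv_coord_mul_apply {v : Hgrp n → ℂ} (hv : ContDiff ℝ ∞ v) (j : Fin n) (p : Hgrp n) :
    fderiv ℝ (fun q : Hgrp n => q.1 j * v q) p (0, 1) = p.1 j * fderiv ℝ v p (0, 1) := by
  have h1 : HasFDerivAt (fun q : Hgrp n => q.1 j)
      ((ContinuousLinearMap.proj (R := ℝ) (φ := fun _ : Fin n => ℂ) j).comp
        (ContinuousLinearMap.fst ℝ (Fin n → ℂ) ℝ)) p :=
    ((ContinuousLinearMap.proj (R := ℝ) (φ := fun _ : Fin n => ℂ) j).comp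
      (ContinuousLinearMap.fst ℝ (Fin n → ℂ) ℝ)).hasFDerivAt
  have h2 := (hv.differentiable (by simp) p).hasFDerivAt
  have h3 : HasFDerivAt (fun q : Hgrp n => q.1 j * v q) _ p := h1.mul h2
  rw [h3.fderiv]
  simp

lemma integral_mul_add_mul_sub_mul {X : Type*} [MeasurableSpace X] {μ : Measure X}
    {F G H : X → ℂ} (hF : Integrable F μ) (hG : Integrable G μ) (hH : Integrable H μ)
    (a b c : ℂ) : ∫ x, (a * F x + b * G x - c * H x) ∂μ =
      a * ∫ x, F x ∂μ + b * ∫ x, G x ∂μ - c * ∫ x, H x ∂μ := by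
  have h := integral_sub ((hF.const_mul a).add (hG.const_mul b)) (hH.const_mul c)
  have h' := integral_add (hF.const_mul a) (hG.const_mul b)
  simp only [Pi.add_apply] at h
  rw [h, h']
  simp_rw [integral_const_mul]

lemma integral_mul_Lbar_eq_neg {u v : Hgrp n → ℂ} (hu : ContDiff ℝ ∞ u)
    (hv : ContDiff ℝ ∞ v) (huc : HasCompactSupport u) (j : Fin n) :
    ∫ p, u p * Lbar j v p = - ∫ p, Lbar j u p * v p := by
  have hw : ContDiff ℝ ∞ fun q : Hgrp n => q.1 j * v q := (contDiff_fst_apply j).mul hv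
  have e1 := integral_mul_fderiv_eq_neg hu hv huc (Pi.single j 1, 0)
  have e2 := integral_mul_fderiv_eq_neg hu hv huc (Pi.single j Complex.I, 0)
  have e3 := integral_mul_fderiv_eq_neg hu hw huc (0, 1)
  simp_rw [fderiv_coord_mul_apply hv] at e3
  have cu := fun w => (contDiff_fderiv_apply_const hu w).continuous
  have cv := fun w => (contDiff_fderiv_apply_const hv w).continuous
  have cj := (contDiff_fst_apply (n := n) j).continuous
  have iu : ∀ w, Integrable fun p => u p * fderiv ℝ v p w := fun w =>
    (hu.continuous.mul (cv w)).integrable_of_hasCompactSupport huc.mul_right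
  have iv : ∀ w, Integrable fun p => fderiv ℝ u p w * v p := fun w =>
    ((cu w).mul hv.continuous).integrable_of_hasCompactSupport
      (hasCompactSupport_fderiv_apply_const huc w).mul_right
  have iu' : ∀ w, Integrable fun p => u p * (p.1 j * fderiv ℝ v p w) := fun w =>
    (hu.continuous.mul (cj.mul (cv w))).integrable_of_hasCompactSupport huc.mul_right
  have iv' : ∀ w, Integrable fun p => fderiv ℝ u p w * (p.1 j * v p) := fun w =>
    ((cu w).mul (cj.mul hv.continuous)).integrable_of_hasCompactSupport
      (hasCompactSupport_fderiv_apply_const huc w).mul_right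
  have l : ∀ p, u p * Lbar j v p = (1/2 : ℂ) * (u p * fderiv ℝ v p (Pi.single j 1, 0))
      + (1/2 * Complex.I) * (u p * fderiv ℝ v p (Pi.single j Complex.I, 0))
      - Complex.I * (u p * (p.1 j * fderiv ℝ v p (0, 1))) := by
    intro p; simp only [Lbar, dZbar, dT]; ring
  have r : ∀ p, Lbar j u p * v p = (1/2 : ℂ) * (fderiv ℝ u p (Pi.single j 1, 0) * v p)
      + (1/2 * Complex.I) * (fderiv ℝ u p (Pi.single j Complex.I, 0) * v p)
      - Complex.I * (fderiv ℝ u p (0, 1) * (p.1 j * v p)) := by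
    intro p; simp only [Lbar, dZbar, dT]; ring
  simp_rw [l, r]
  rw [integral_mul_add_mul_sub_mul (iu _) (iu _) (iu' _),
    integral_mul_add_mul_sub_mul (iv _) (iv _) (iv' _)]
  rw [e1, e2, e3]
  ring

/-- The operator `∂/∂z̄_j` on functions of `z`. -/
def dbar (j : Fin n) (ψ : (Fin n → ℂ) → ℂ) (z : Fin n → ℂ) : ℂ :=
  (1/2 : ℂ) * (fderiv ℝ ψ z (Pi.single j 1) + Complex.I * fderiv ℝ ψ z (Pi.single j Complex.I))

lemma contDiff_exp_mul_comp_fst (c : ℝ) {ψ : (Fin n → ℂ) → ℂ} (hψ : ContDiff ℝ ∞ ψ) :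
    ContDiff ℝ ∞ fun p : Hgrp n => Complex.exp (Complex.I * c * p.2) * ψ p.1 := by
  have h : ContDiff ℝ ∞ fun p : Hgrp n => (p.2 : ℂ) := Complex.ofRealCLM.contDiff.comp contDiff_snd
  exact ((contDiff_const.mul h).cexp).mul (hψ.comp contDiff_fst)

lemma Lbar_exp_mul (c : ℝ) {ψ : (Fin n → ℂ) → ℂ} (hψ : ContDiff ℝ ∞ ψ) (j : Fin n)
    (p : Hgrp n) :
    Lbar j (fun p : Hgrp n => Complex.exp (Complex.I * c * p.2) * ψ p.1) p =
      Complex.exp (Complex.I * c * p.2) * (dbar j ψ p.1 + c * p.1 j * ψ p.1) := by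
  have h1 : HasFDerivAt (fun p : Hgrp n => Complex.I * c * (p.2 : ℂ))
      ((Complex.I * c) • (Complex.ofRealCLM.comp (ContinuousLinearMap.snd ℝ (Fin n → ℂ) ℝ))) p :=
    (Complex.ofRealCLM.comp (ContinuousLinearMap.snd ℝ (Fin n → ℂ) ℝ)).hasFDerivAt.const_mul _
  have h2 : HasFDerivAt (fun p : Hgrp n => ψ p.1)
      ((fderiv ℝ ψ p.1).comp (ContinuousLinearMap.fst ℝ (Fin n → ℂ) ℝ)) p :=
    (hψ.differentiable (by simp) p.1).hasFDerivAt.comp p hasFDerivAt_fst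
  have h3 : HasFDerivAt (fun p : Hgrp n => Complex.exp (Complex.I * c * p.2) * ψ p.1) _ p :=
    h1.cexp.mul h2
  simp only [Lbar, dZbar, dT, dbar]
  rw [h3.fderiv]
  simp
  linear_combination (- c * p.1 j * ψ p.1 * Complex.exp (Complex.I * c * p.2)) * Complex.I_sq

end Smoothness

section PartialFourier

variable {n : ℕ}

lemma pFourier_eq (f : Hgrp n → ℂ) (z : Fin n → ℂ) (ξ : ℝ) :
    pFourier f z ξ = unitaryFourier (fun t => f (z, t)) ξ := rfl

lemma pFourier_eq_zero {f : Hgrp n → ℂ} {z : Fin n → ℂ} (hz : z ∉ Prod.fst '' tsupport f)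
    (ξ : ℝ) : pFourier f z ξ = 0 := by
  have : ∀ t, f (z, t) = 0 := fun t =>
    image_eq_zero_of_notMem_tsupport fun h => hz ⟨_, h, rfl⟩
  simp [pFourier, this]

lemma isCompact_fst_tsupport {f : Hgrp n → ℂ} (hfc : HasCompactSupport f) :
    IsCompact (Prod.fst '' tsupport f) := hfc.isCompact.image continuous_fst

lemma hasCompactSupport_pFourier {f : Hgrp n → ℂ} (hfc : HasCompactSupport f) (ξ : ℝ) :
    HasCompactSupport fun z => pFourier f z ξ :=
  HasCompactSupport.intro (isCompact_fst_tsupport hfc) fun _ hz => pFourier_eq_zero hz ξ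

lemma continuous_pFourier {f : Hgrp n → ℂ} (hf : Continuous f) (hfc : HasCompactSupport f) :
    Continuous fun q : (Fin n → ℂ) × ℝ => pFourier f q.1 q.2 := by
  have hK : IsCompact (Prod.snd '' tsupport f) := hfc.isCompact.image continuous_snd
  have h := continuous_parametric_integral_of_continuous (μ := (volume : Measure ℝ))
    (f := fun (q : (Fin n → ℂ) × ℝ) (t : ℝ) =>
      f (q.1, t) * Complex.exp (-Complex.I * q.2 * t)) (by fun_prop) hK
  have e : ∀ q : (Fin n → ℂ) × ℝ, pFourier f q.1 q.2 = (Real.sqrt (2 * Real.pi))⁻¹ •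
      ∫ t in Prod.snd '' tsupport f, f (q.1, t) * Complex.exp (-Complex.I * q.2 * t) := by
    intro q
    rw [pFourier, setIntegral_eq_integral_of_forall_compl_eq_zero]
    intro t ht
    rw [image_eq_zero_of_notMem_tsupport fun h => ht ⟨_, h, rfl⟩, zero_mul]
  simp_rw [e]
  exact Continuous.const_smul h (Real.sqrt (2 * Real.pi))⁻¹

lemma integral_pFourier_mul {f : Hgrp n → ℂ} (hf : Continuous f) (hfc : HasCompactSupport f)
    {ψ : (Fin n → ℂ) → ℂ} (hψ : Continuous ψ) (ξ : ℝ) :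
    ∫ z, pFourier f z ξ * ψ z = (Real.sqrt (2 * Real.pi))⁻¹ •
      ∫ p : Hgrp n, f p * (Complex.exp (-Complex.I * ξ * p.2) * ψ p.1) := by
  have hi : Integrable (fun p : Hgrp n => f p * (Complex.exp (-Complex.I * ξ * p.2) * ψ p.1)) := by
    refine Continuous.integrable_of_hasCompactSupport ?_ hfc.mul_right
    fun_prop
  rw [Measure.volume_eq_prod] at hi ⊢
  rw [integral_prod _ hi, ← integral_smul]
  refine integral_congr_ae (Eventually.of_forall fun z => ?_)
  simp only [pFourier, smul_mul_assoc]
  rw [← integral_mul_const]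
  simp_rw [mul_assoc]

/-- Weak form of the identity `(∂/∂z̄_j + ξ z_j) Ff(·,ξ) = F(L̄_j f)(·,ξ)`. -/
lemma integral_pFourier_Lbar_mul {f : Hgrp n → ℂ} (hf : ContDiff ℝ ∞ f)
    (hfc : HasCompactSupport f) {ψ : (Fin n → ℂ) → ℂ} (hψ : ContDiff ℝ ∞ ψ) (j : Fin n) (ξ : ℝ) :
    ∫ z, pFourier (Lbar j f) z ξ * ψ z =
      ∫ z, pFourier f z ξ * (ξ * z j * ψ z - dbar j ψ z) := by
  have hd : Continuous fun z => (ξ * z j * ψ z - dbar j ψ z : ℂ) := by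
    have h : ∀ v, Continuous fun z => fderiv ℝ ψ z v := fun v =>
      ((hψ.fderiv_right (m := 0) (by simp)).clm_apply contDiff_const).continuous
    have := hψ.continuous
    have h1 := h (Pi.single j 1)
    have h2 := h (Pi.single j Complex.I)
    unfold dbar
    fun_prop
  rw [integral_pFourier_mul hf.continuous hfc hd,
    integral_pFourier_mul (contDiff_Lbar hf j).continuous (hasCompactSupport_Lbar hfc j)
      hψ.continuous]
  congr 1
  have e := integral_mul_Lbar_eq_neg hf (contDiff_exp_mul_comp_fst (-ξ) hψ) hfc j
  simp_rw [Lbar_exp_mul (-ξ) hψ] at e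
  have e' := neg_eq_iff_eq_neg.mpr e
  rw [← integral_neg] at e'
  convert e'.symm using 3 with p p
  · push_cast; ring_nf
  · push_cast; ring_nf

end PartialFourier

section Kernel

variable {n : ℕ}

open ComplexConjugate

/-- The twisted Gaussian kernel on `ℂⁿ`. -/
def twistedKernel (ξ α : ℝ) (z w : Fin n → ℂ) : ℂ :=
  cexp (∑ i, (ξ * (z i * conj (w i) - conj (z i) * w i) - α * ((z i - w i) * conj (z i - w i))))

lemma twistedKernel_conj (ξ α : ℝ) (z w : Fin n → ℂ) :
    conj (twistedKernel ξ α z w) = twistedKernel ξ α w z := by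
  rw [twistedKernel, ← Complex.exp_conj, twistedKernel, map_sum]
  congr 1
  refine Finset.sum_congr rfl fun i _ => ?_
  simp only [map_sub, map_mul, Complex.conj_conj, Complex.conj_ofReal]
  ring

lemma twistedKernel_swap (ξ α : ℝ) (z w : Fin n → ℂ) :
    twistedKernel ξ α z w = twistedKernel (-ξ) α w z := by
  rw [twistedKernel, twistedKernel]
  congr 1
  refine Finset.sum_congr rfl fun i _ => ?_
  simp only [map_sub, Complex.ofReal_neg]
  ring

lemma norm_twistedKernel (ξ α : ℝ) (z w : Fin n → ℂ) :
    ‖twistedKernel ξ α z w‖ = Real.exp (-α * nsq (z - w)) := by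
  rw [twistedKernel, Complex.norm_exp, Complex.re_sum, nsq, Finset.mul_sum]
  congr 1
  refine Finset.sum_congr rfl fun i _ => ?_
  rw [Complex.mul_conj]
  simp [Complex.mul_re, Complex.mul_im]

lemma nsq_nonneg (z : Fin n → ℂ) : 0 ≤ nsq z := Finset.sum_nonneg fun _ _ => Complex.normSq_nonneg _

@[fun_prop]
lemma continuous_nsq : Continuous (nsq : (Fin n → ℂ) → ℝ) :=
  continuous_finsetSum _ fun i _ => Complex.continuous_normSq.comp (continuous_apply i)

lemma norm_twistedKernel_le_one (ξ : ℝ) {α : ℝ} (hα : 0 ≤ α) (z w : Fin n → ℂ) :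
    ‖twistedKernel ξ α z w‖ ≤ 1 := by
  rw [norm_twistedKernel, Real.exp_le_one_iff]
  have := mul_nonneg hα (nsq_nonneg (z - w))
  linarith

@[fun_prop]
lemma Continuous.twistedKernel {X : Type*} [TopologicalSpace X] {a b : X → ℝ}
    {u v : X → Fin n → ℂ} (ha : Continuous a) (hb : Continuous b) (hu : Continuous u)
    (hv : Continuous v) : Continuous fun x => twistedKernel (a x) (b x) (u x) (v x) := by
  unfold _root_.twistedKernel
  have hu' : ∀ i, Continuous fun x => u x i := fun i => (continuous_apply i).comp hu
  have hv' : ∀ i, Continuous fun x => v x i := fun i => (continuous_apply i).comp hv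
  have ha' : Continuous fun x => (a x : ℂ) := Complex.continuous_ofReal.comp ha
  have hb' : Continuous fun x => (b x : ℂ) := Complex.continuous_ofReal.comp hb
  have hc : ∀ {c : X → ℂ}, Continuous c → Continuous fun x => conj (c x) := fun h =>
    Complex.continuous_conj.comp h
  exact Complex.continuous_exp.comp (continuous_finsetSum _ fun i _ =>
    (ha'.mul (((hu' i).mul (hc (hv' i))).sub ((hc (hu' i)).mul (hv' i)))).sub
      (hb'.mul (((hu' i).sub (hv' i)).mul (hc ((hu' i).sub (hv' i))))))

lemma contDiff_conj_apply (i : Fin n) : ContDiff ℝ ∞ fun z : Fin n → ℂ => conj (z i) :=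
  Complex.conjCLE.contDiff.comp (contDiff_apply ℝ ℂ i)

lemma contDiff_twistedKernel_exponent (ξ α : ℝ) (w : Fin n → ℂ) (i : Fin n) :
    ContDiff ℝ ∞ fun z : Fin n → ℂ =>
      (ξ * (z i * conj (w i) - conj (z i) * w i) - α * ((z i - w i) * conj (z i - w i)) : ℂ) := by
  have h1 : ContDiff ℝ ∞ fun z : Fin n → ℂ => z i := contDiff_apply ℝ ℂ i
  have h2 := contDiff_conj_apply i
  simp only [map_sub]
  exact (contDiff_const.mul ((h1.mul contDiff_const).sub (h2.mul contDiff_const))).sub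
    (contDiff_const.mul ((h1.sub contDiff_const).mul (h2.sub contDiff_const)))

lemma contDiff_twistedKernel_left (ξ α : ℝ) (w : Fin n → ℂ) :
    ContDiff ℝ ∞ fun z => twistedKernel ξ α z w :=
  (ContDiff.sum fun i _ => contDiff_twistedKernel_exponent ξ α w i).cexp

lemma dbar_cexp {φ : (Fin n → ℂ) → ℂ} {z : Fin n → ℂ} (hφ : DifferentiableAt ℝ φ z) (j : Fin n) :
    dbar j (fun z => cexp (φ z)) z = dbar j φ z * cexp (φ z) := by
  simp only [dbar, hφ.hasFDerivAt.cexp.fderiv]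
  simp
  ring

lemma dbar_mul {φ ψ : (Fin n → ℂ) → ℂ} {z : Fin n → ℂ} (hφ : DifferentiableAt ℝ φ z)
    (hψ : DifferentiableAt ℝ ψ z) (j : Fin n) :
    dbar j (fun z => φ z * ψ z) z = φ z * dbar j ψ z + dbar j φ z * ψ z := by
  have h : HasFDerivAt (fun z => φ z * ψ z) _ z := hφ.hasFDerivAt.mul hψ.hasFDerivAt
  simp only [dbar, h.fderiv]
  simp
  ring

lemma dbar_sub_conj (w : Fin n → ℂ) (j : Fin n) (z : Fin n → ℂ) :
    dbar j (fun z => conj (w j - z j)) z = -1 := by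
  have h1 : HasFDerivAt (fun z : Fin n → ℂ => conj (w j - z j))
      ((Complex.conjCLE : ℂ →L[ℝ] ℂ).comp
        (-(ContinuousLinearMap.proj (R := ℝ) (φ := fun _ : Fin n => ℂ) j))) z := by
    refine HasFDerivAt.comp (g := conj) z (Complex.conjCLE : ℂ →L[ℝ] ℂ).hasFDerivAt ?_
    exact (ContinuousLinearMap.proj (R := ℝ) (φ := fun _ : Fin n => ℂ) j).hasFDerivAt.const_sub _
  simp only [dbar, h1.fderiv]
  simp
  norm_num

lemma dbar_twistedKernel_left (ξ α : ℝ) (w : Fin n → ℂ) (j : Fin n) (z : Fin n → ℂ) :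
    dbar j (fun z => twistedKernel ξ α z w) z =
      (-ξ * w j - α * (z j - w j)) * twistedKernel ξ α z w := by
  unfold twistedKernel
  rw [dbar_cexp ((ContDiff.sum fun i _ => contDiff_twistedKernel_exponent ξ α w
    i).differentiable (by simp) z)]
  congr 1
  have hp : ∀ i, HasFDerivAt (fun z : Fin n → ℂ => z i)
      (ContinuousLinearMap.proj (R := ℝ) (φ := fun _ : Fin n => ℂ) i) z := fun i =>
    (ContinuousLinearMap.proj (R := ℝ) (φ := fun _ : Fin n => ℂ) i).hasFDerivAt
  have hc : ∀ i, HasFDerivAt (fun z : Fin n → ℂ => conj (z i))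
      ((Complex.conjCLE : ℂ →L[ℝ] ℂ).comp
        (ContinuousLinearMap.proj (R := ℝ) (φ := fun _ : Fin n => ℂ) i)) z := fun i =>
    HasFDerivAt.comp (g := conj) z (Complex.conjCLE : ℂ →L[ℝ] ℂ).hasFDerivAt (hp i)
  have ht := fun i => ((((hp i).mul_const (conj (w i))).sub ((hc i).mul_const (w i))).const_mul
    (ξ : ℂ)).sub ((((hp i).sub_const (w i)).mul ((hc i).sub_const (conj (w i)))).const_mul (α : ℂ))
  have hs : HasFDerivAt (fun z : Fin n → ℂ => ∑ i,
      (ξ * (z i * conj (w i) - conj (z i) * w i) - α * ((z i - w i) * (conj (z i) - conj (w i))) : ℂ))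
      _ z := HasFDerivAt.fun_sum fun i (_ : i ∈ Finset.univ) => ht i
  simp only [map_sub]
  simp only [dbar, hs.fderiv]
  simp only [sum_apply]
  rw [Finset.sum_eq_single j (fun i _ hi => by simp [Pi.single_eq_of_ne hi]) (by simp),
    Finset.sum_eq_single j (fun i _ hi => by simp [Pi.single_eq_of_ne hi]) (by simp)]
  simp
  linear_combination (1 / 2 : ℂ) * (ξ * conj (w j) + ξ * w j + α * conj (w j) - α * w j + α * z j
    - α * conj (z j)) * Complex.I_sq

end Kernel

section Gaussian

variable {n : ℕ}

open ComplexConjugate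

lemma gaussian_exponent_split (b : ℝ) (A B : ℂ) (x y : ℝ) :
    cexp (-b * ((x + y * I) * conj (x + y * I : ℂ)) + A * (x + y * I) + B * conj (x + y * I : ℂ)) =
      cexp (-b * x ^ 2 + (A + B) * x + 0) * cexp (-b * y ^ 2 + (I * (A - B)) * y + 0) := by
  rw [← Complex.exp_add]
  congr 1
  simp only [map_add, map_mul, Complex.conj_ofReal, Complex.conj_I]
  linear_combination (b * y ^ 2 : ℂ) * Complex.I_sq

lemma integrable_complex_gaussian {b : ℝ} (hb : 0 < b) (A B : ℂ) :
    Integrable fun v : ℂ => cexp (-b * (v * conj v) + A * v + B * conj v) := by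
  have hb' : (-b : ℂ).re < 0 := by simpa using hb
  have h := (integrable_cexp_quadratic' hb' (A + B) 0).mul_prod
    (integrable_cexp_quadratic' hb' (I * (A - B)) 0)
  rw [← Measure.volume_eq_prod, ← Complex.volume_preserving_equiv_real_prod.integrable_comp_emb
    Complex.measurableEquivRealProd.measurableEmbedding] at h
  refine h.congr (Eventually.of_forall fun v => ?_)
  have e := gaussian_exponent_split b A B v.re v.im
  rw [Complex.re_add_im] at e
  simp only [Function.comp_apply, Complex.measurableEquivRealProd_apply, e]

lemma integral_complex_gaussian {b : ℝ} (hb : 0 < b) (A B : ℂ) :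
    ∫ v : ℂ, cexp (-b * (v * conj v) + A * v + B * conj v) = (Real.pi / b) * cexp (A * B / b) := by
  have hb' : (-b : ℂ).re < 0 := by simpa using hb
  have hb0 : (b : ℂ) ≠ 0 := by exact_mod_cast hb.ne'
  have e : ∀ v : ℂ, cexp (-b * (v * conj v) + A * v + B * conj v) =
      (fun p : ℝ × ℝ => cexp (-b * p.1 ^ 2 + (A + B) * p.1 + 0) *
        cexp (-b * p.2 ^ 2 + (I * (A - B)) * p.2 + 0)) (Complex.measurableEquivRealProd v) := by
    intro v
    have e := gaussian_exponent_split b A B v.re v.im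
    rw [Complex.re_add_im] at e
    simp only [Complex.measurableEquivRealProd_apply, e]
  refine (integral_congr_ae (Eventually.of_forall e)).trans
    ((Complex.volume_preserving_equiv_real_prod.integral_comp
      Complex.measurableEquivRealProd.measurableEmbedding
      (fun p : ℝ × ℝ => cexp (-b * p.1 ^ 2 + (A + B) * p.1 + 0) *
        cexp (-b * p.2 ^ 2 + (I * (A - B)) * p.2 + 0))).trans ?_)
  rw [Measure.volume_eq_prod,
    integral_prod_mul (fun x : ℝ => cexp (-b * x ^ 2 + (A + B) * x + 0))
      (fun y : ℝ => cexp (-b * y ^ 2 + (I * (A - B)) * y + 0)),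
    integral_cexp_quadratic hb', integral_cexp_quadratic hb', mul_mul_mul_comm, ← Complex.exp_add,
    neg_neg]
  congr 1
  · have hp : (Real.pi / b : ℂ) ≠ 0 :=
      div_ne_zero (by exact_mod_cast Real.pi_ne_zero) hb0
    rw [← Complex.cpow_add _ _ hp]
    norm_num
  · congr 1
    field_simp
    linear_combination ((A - B) ^ 2 : ℂ) * Complex.I_sq

lemma gaussian_sum_eq_prod (b : ℝ) (A B v : Fin n → ℂ) :
    cexp (∑ i, (-b * (v i * conj (v i)) + A i * v i + B i * conj (v i))) =
      ∏ i, cexp (-b * (v i * conj (v i)) + A i * v i + B i * conj (v i)) :=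
  Complex.exp_sum _ _

lemma integrable_pi_gaussian {b : ℝ} (hb : 0 < b) (A B : Fin n → ℂ) :
    Integrable fun v : Fin n → ℂ =>
      cexp (∑ i, (-b * (v i * conj (v i)) + A i * v i + B i * conj (v i))) := by
  simp_rw [gaussian_sum_eq_prod]
  exact Integrable.fintype_prod (μ := fun _ => volume)
    (f := fun i (v : ℂ) => cexp (-b * (v * conj v) + A i * v + B i * conj v))
    fun i => integrable_complex_gaussian hb (A i) (B i)

lemma integral_pi_gaussian {b : ℝ} (hb : 0 < b) (A B : Fin n → ℂ) :
    ∫ v : Fin n → ℂ, cexp (∑ i, (-b * (v i * conj (v i)) + A i * v i + B i * conj (v i))) =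
      (Real.pi / b) ^ n * cexp (∑ i, A i * B i / b) := by
  simp_rw [gaussian_sum_eq_prod]
  rw [integral_fintype_prod_volume_eq_prod
    (fun i (v : ℂ) => cexp (-b * (v * conj v) + A i * v + B i * conj v))]
  simp_rw [integral_complex_gaussian hb]
  rw [Finset.prod_mul_distrib, Complex.exp_sum]
  simp [div_pow]

lemma nsq_eq_sum (v : Fin n → ℂ) : (nsq v : ℂ) = ∑ i, v i * conj (v i) := by
  simp [nsq, Complex.mul_conj]

lemma cexp_neg_nsq (b : ℝ) (v : Fin n → ℂ) : (Real.exp (-b * nsq v) : ℂ) =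
    cexp (∑ i, (-b * (v i * conj (v i)) + (0 : Fin n → ℂ) i * v i +
      (0 : Fin n → ℂ) i * conj (v i))) := by
  rw [Complex.ofReal_exp]
  congr 1
  push_cast
  rw [nsq_eq_sum, Finset.mul_sum]
  simp

lemma integrable_exp_neg_nsq {b : ℝ} (hb : 0 < b) :
    Integrable fun v : Fin n → ℂ => Real.exp (-b * nsq v) := by
  have h := (integrable_pi_gaussian hb (0 : Fin n → ℂ) 0).re
  simp_rw [← cexp_neg_nsq] at h
  exact h

lemma integral_exp_neg_nsq {b : ℝ} (hb : 0 < b) :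
    ∫ v : Fin n → ℂ, Real.exp (-b * nsq v) = (Real.pi / b) ^ n := by
  have h := integral_pi_gaussian hb (0 : Fin n → ℂ) 0
  simp_rw [← cexp_neg_nsq, integral_complex_ofReal] at h
  simp only [Pi.zero_apply, mul_zero, zero_div, Finset.sum_const_zero, Complex.exp_zero,
    mul_one] at h
  exact_mod_cast h

lemma twistedKernel_mul_eq (ξ β : ℝ) (z w v : Fin n → ℂ) :
    twistedKernel ξ β z v * twistedKernel ξ β v w =
      cexp (-β * ∑ i, (z i * conj (z i) + w i * conj (w i))) *
      cexp (∑ i, (-(2 * β : ℝ) * (v i * conj (v i)) +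
        (fun i => (β - ξ) * conj (z i) + (β + ξ) * conj (w i)) i * v i +
        (fun i => (β + ξ) * z i + (β - ξ) * w i) i * conj (v i))) := by
  rw [twistedKernel, twistedKernel, ← Complex.exp_add, ← Complex.exp_add, ← Finset.sum_add_distrib,
    Finset.mul_sum, ← Finset.sum_add_distrib]
  congr 1
  refine Finset.sum_congr rfl fun i _ => ?_
  simp only [map_sub]
  push_cast
  ring

lemma integral_twistedKernel_mul (ξ : ℝ) {β : ℝ} (hβ : 0 < β) (z w : Fin n → ℂ) :
    ∫ v, twistedKernel ξ β z v * twistedKernel ξ β v w =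
      (Real.pi / (2 * β)) ^ n * twistedKernel ξ ((β ^ 2 + ξ ^ 2) / (2 * β)) z w := by
  simp_rw [twistedKernel_mul_eq ξ β z w]
  rw [integral_const_mul, integral_pi_gaussian (by positivity), mul_left_comm, ← Complex.exp_add,
    twistedKernel, Finset.mul_sum, ← Finset.sum_add_distrib]
  push_cast
  congr 2
  refine Finset.sum_congr rfl fun i _ => ?_
  have : (β : ℂ) ≠ 0 := by exact_mod_cast hβ.ne'
  simp only [map_sub]
  field_simp
  ring

end Gaussian

section QuadraticForm

variable {n : ℕ}

open ComplexConjugate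

lemma hasCompactSupport_mul_conj {F H : (Fin n → ℂ) → ℂ} (hF : HasCompactSupport F)
    (hH : HasCompactSupport H) :
    HasCompactSupport fun q : (Fin n → ℂ) × (Fin n → ℂ) => F q.2 * conj (H q.1) := by
  refine HasCompactSupport.intro (hH.isCompact.prod hF.isCompact) fun q hq => ?_
  rw [Set.mem_prod, not_and_or] at hq
  rcases hq with h | h
  · simp [image_eq_zero_of_notMem_tsupport h]
  · simp [image_eq_zero_of_notMem_tsupport h]

lemma continuous_mul_conj {F H : (Fin n → ℂ) → ℂ} (hF : Continuous F) (hH : Continuous H) :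
    Continuous fun q : (Fin n → ℂ) × (Fin n → ℂ) => F q.2 * conj (H q.1) :=
  (hF.comp continuous_snd).mul (Complex.continuous_conj.comp (hH.comp continuous_fst))

lemma integrable_norm_sq {F : (Fin n → ℂ) → ℂ} (hF : Continuous F) (hFc : HasCompactSupport F) :
    Integrable fun z => ‖F z‖ ^ 2 := by
  refine (hF.norm.pow 2).integrable_of_hasCompactSupport ?_
  refine HasCompactSupport.intro hFc.isCompact fun z hz => ?_
  simp [image_eq_zero_of_notMem_tsupport hz]

lemma integrable_mul_mul_conj {F H : (Fin n → ℂ) → ℂ} (hF : Continuous F) (hH : Continuous H)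
    (hFc : HasCompactSupport F) (hHc : HasCompactSupport H)
    {c : (Fin n → ℂ) × (Fin n → ℂ) → ℂ} (hc : Continuous c) :
    Integrable fun q : (Fin n → ℂ) × (Fin n → ℂ) => c q * (F q.2 * conj (H q.1)) :=
  (hc.mul (continuous_mul_conj hF hH)).integrable_of_hasCompactSupport
    (hasCompactSupport_mul_conj hFc hHc).mul_left

/-- The Hermitian form with kernel `twistedKernel ξ α`. -/
def twistedForm (ξ α : ℝ) (F : (Fin n → ℂ) → ℂ) : ℂ :=
  ∫ q : (Fin n → ℂ) × (Fin n → ℂ), twistedKernel ξ α q.1 q.2 * (F q.2 * conj (F q.1))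

/-- The integral operator with kernel `twistedKernel ξ α`. -/
def twistedOp (ξ α : ℝ) (F : (Fin n → ℂ) → ℂ) (z : Fin n → ℂ) : ℂ :=
  ∫ w, twistedKernel ξ α z w * F w

lemma conj_twistedOp (ξ α : ℝ) (F : (Fin n → ℂ) → ℂ) (v : Fin n → ℂ) :
    conj (twistedOp ξ α F v) = ∫ z, twistedKernel ξ α z v * conj (F z) := by
  rw [twistedOp, ← integral_conj]
  simp_rw [map_mul, twistedKernel_conj]

lemma continuous_twistedOp (ξ α : ℝ) {F : (Fin n → ℂ) → ℂ} (hF : Continuous F)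
    (hFc : HasCompactSupport F) : Continuous (twistedOp ξ α F) := by
  have h := continuous_parametric_integral_of_continuous (μ := (volume : Measure (Fin n → ℂ)))
    (f := fun z w => twistedKernel ξ α z w * F w) (by fun_prop) hFc.isCompact
  have e : ∀ z, twistedOp ξ α F z = ∫ w in tsupport F, twistedKernel ξ α z w * F w := by
    intro z
    rw [twistedOp, setIntegral_eq_integral_of_forall_compl_eq_zero]
    intro w hw
    rw [image_eq_zero_of_notMem_tsupport hw, mul_zero]
  rw [funext e]
  exact h

lemma integrable_twistedKernel_triple (ξ : ℝ) {β : ℝ} (hβ : 0 < β) {F : (Fin n → ℂ) → ℂ}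
    (hF : Continuous F) (hFc : HasCompactSupport F) :
    Integrable (fun p : ((Fin n → ℂ) × (Fin n → ℂ)) × (Fin n → ℂ) =>
      twistedKernel ξ β p.1.1 p.2 * twistedKernel ξ β p.2 p.1.2 * (F p.1.2 * conj (F p.1.1)))
      (volume.prod volume) := by
  have hcF := continuous_mul_conj hF hF
  have hg : Integrable (fun p : ((Fin n → ℂ) × (Fin n → ℂ)) × (Fin n → ℂ) =>
      ‖F p.1.2 * conj (F p.1.1)‖ * Real.exp (-β * nsq (p.1.1 - p.2))) (volume.prod volume) := by
    rw [integrable_prod_iff]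
    · refine ⟨Eventually.of_forall fun q => ?_, ?_⟩
      · exact ((integrable_exp_neg_nsq hβ).comp_sub_left q.1).const_mul
          ‖F q.2 * conj (F q.1)‖
      · have e : ∀ q : (Fin n → ℂ) × (Fin n → ℂ), ∫ v : Fin n → ℂ,
            ‖‖F q.2 * conj (F q.1)‖ * Real.exp (-β * nsq (q.1 - v))‖ =
            ‖F q.2 * conj (F q.1)‖ * (Real.pi / β) ^ n := by
          intro q
          rw [← integral_exp_neg_nsq hβ, ← integral_sub_left_eq_self
            (fun v : Fin n → ℂ => Real.exp (-β * nsq v)) volume q.1, ← integral_const_mul]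
          refine integral_congr_ae (Eventually.of_forall fun v => ?_)
          simp only [norm_mul, Real.norm_eq_abs, Real.abs_exp, abs_norm]
        simp_rw [e]
        exact ((hcF.integrable_of_hasCompactSupport
          (hasCompactSupport_mul_conj hFc hFc)).norm).mul_const _
    · refine Continuous.aestronglyMeasurable ?_
      have h2 : Continuous fun p : ((Fin n → ℂ) × (Fin n → ℂ)) × (Fin n → ℂ) =>
        nsq (p.1.1 - p.2) := continuous_nsq.comp (by fun_prop)
      exact (hcF.comp continuous_fst).norm.mul (Real.continuous_exp.comp (continuous_const.mul h2))
  refine hg.mono' (Continuous.aestronglyMeasurable ?_) (Eventually.of_forall fun p => ?_)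
  · have h1 : Continuous fun p : ((Fin n → ℂ) × (Fin n → ℂ)) × (Fin n → ℂ) =>
      twistedKernel ξ β p.1.1 p.2 * twistedKernel ξ β p.2 p.1.2 := by fun_prop
    exact h1.mul (hcF.comp continuous_fst)
  · rw [norm_mul, norm_mul, norm_twistedKernel, mul_comm]
    refine mul_le_mul_of_nonneg_left ?_ (norm_nonneg _)
    exact mul_le_of_le_one_right (Real.exp_nonneg _) (norm_twistedKernel_le_one ξ hβ.le _ _)

lemma integral_twistedKernel_triple_left (ξ β : ℝ) (F : (Fin n → ℂ) → ℂ) (v : Fin n → ℂ) :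
    ∫ q : (Fin n → ℂ) × (Fin n → ℂ),
      twistedKernel ξ β q.1 v * twistedKernel ξ β v q.2 * (F q.2 * conj (F q.1)) =
      ((‖twistedOp ξ β F v‖ ^ 2 : ℝ) : ℂ) := by
  have e : ∀ q : (Fin n → ℂ) × (Fin n → ℂ),
      twistedKernel ξ β q.1 v * twistedKernel ξ β v q.2 * (F q.2 * conj (F q.1)) =
      (twistedKernel ξ β q.1 v * conj (F q.1)) * (twistedKernel ξ β v q.2 * F q.2) := fun q => by
    ring
  simp_rw [e]
  rw [Measure.volume_eq_prod, integral_prod_mul (fun z => twistedKernel ξ β z v * conj (F z))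
    (fun w => twistedKernel ξ β v w * F w), ← conj_twistedOp, ← twistedOp, Complex.conj_mul']
  push_cast
  rfl

lemma integrable_norm_twistedOp_sq (ξ : ℝ) {β : ℝ} (hβ : 0 < β) {F : (Fin n → ℂ) → ℂ}
    (hF : Continuous F) (hFc : HasCompactSupport F) :
    Integrable fun v => ‖twistedOp ξ β F v‖ ^ 2 := by
  have h := (integrable_twistedKernel_triple ξ hβ hF hFc).integral_prod_right
  simp_rw [integral_twistedKernel_triple_left] at h
  exact_mod_cast h.re

lemma integral_norm_twistedOp_sq (ξ : ℝ) {β : ℝ} (hβ : 0 < β) {F : (Fin n → ℂ) → ℂ}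
    (hF : Continuous F) (hFc : HasCompactSupport F) :
    ((∫ v, ‖twistedOp ξ β F v‖ ^ 2 : ℝ) : ℂ) =
      (Real.pi / (2 * β)) ^ n * twistedForm ξ ((β ^ 2 + ξ ^ 2) / (2 * β)) F := by
  have h := integrable_twistedKernel_triple ξ hβ hF hFc
  have e := (integral_prod_symm _ h).symm.trans (integral_prod _ h)
  simp_rw [integral_twistedKernel_triple_left, integral_mul_const,
    integral_twistedKernel_mul ξ hβ, mul_assoc, integral_const_mul] at e
  rw [integral_complex_ofReal] at e
  rw [e, twistedForm]

lemma integral_twistedOp_mul_conj (ξ β : ℝ) {F : (Fin n → ℂ) → ℂ}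
    (hF : Continuous F) (hFc : HasCompactSupport F) :
    ∫ z, twistedOp ξ β F z * conj (F z) = twistedForm ξ β F := by
  have h := integrable_mul_mul_conj hF hF hFc hFc
    (c := fun q => twistedKernel ξ β q.1 q.2) (by fun_prop)
  rw [twistedForm, Measure.volume_eq_prod, integral_prod _ (by rwa [← Measure.volume_eq_prod])]
  refine integral_congr_ae (Eventually.of_forall fun z => ?_)
  simp only [twistedOp]
  rw [← integral_mul_const]
  simp_rw [mul_assoc]

/-- The normalized Hermitian form. -/
def normalizedForm (ξ : ℝ) (F : (Fin n → ℂ) → ℂ) (α : ℝ) : ℝ :=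
  ((α + ξ) / Real.pi) ^ n * (twistedForm ξ α F).re

lemma normalizedForm_nonneg {ξ α : ℝ} (hξ : 0 < ξ) (hα : ξ ≤ α) {F : (Fin n → ℂ) → ℂ}
    (hF : Continuous F) (hFc : HasCompactSupport F) : 0 ≤ normalizedForm ξ F α := by
  set s := Real.sqrt (α ^ 2 - ξ ^ 2) with hs
  have hs2 : s ^ 2 = α ^ 2 - ξ ^ 2 := Real.sq_sqrt (by nlinarith)
  have hs0 : 0 ≤ s := Real.sqrt_nonneg _
  have hβ : 0 < α + s := by linarith
  have e : ((α + s) ^ 2 + ξ ^ 2) / (2 * (α + s)) = α := by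
    rw [div_eq_iff (by positivity)]
    linear_combination hs2
  have h := congrArg Complex.re (integral_norm_twistedOp_sq ξ hβ hF hFc)
  rw [e, Complex.ofReal_re] at h
  have hc : ((Real.pi / (2 * ((α + s : ℝ) : ℂ))) ^ n : ℂ) =
      (((Real.pi / (2 * (α + s))) ^ n : ℝ) : ℂ) := by push_cast; rfl
  rw [hc, Complex.re_ofReal_mul] at h
  have hp : 0 < (Real.pi / (2 * (α + s))) ^ n := by positivity
  have h0 : 0 ≤ ∫ v, ‖twistedOp ξ (α + s) F v‖ ^ 2 := integral_nonneg fun v => by positivity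
  rw [h] at h0
  have h1 : 0 ≤ (twistedForm ξ α F).re := nonneg_of_mul_nonneg_right h0 hp
  have : 0 < α := by linarith
  exact mul_nonneg (by positivity) h1

/-- The orthogonal projection onto the null space of `∂/∂z̄_j + ξ z_j`. -/
def bargmannProj (ξ : ℝ) (F : (Fin n → ℂ) → ℂ) (z : Fin n → ℂ) : ℂ :=
  ((2 * ξ / Real.pi) ^ n : ℝ) * twistedOp ξ ξ F z

lemma integrable_norm_sub_bargmannProj_sq {ξ : ℝ} (hξ : 0 < ξ) {F : (Fin n → ℂ) → ℂ}
    (hF : Continuous F) (hFc : HasCompactSupport F) :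
    Integrable fun z => ‖F z - bargmannProj ξ F z‖ ^ 2 := by
  have h1 : MemLp F 2 := hF.memLp_of_hasCompactSupport hFc
  have h2 : MemLp (twistedOp ξ ξ F) 2 :=
    (memLp_two_iff_integrable_sq_norm
      (continuous_twistedOp ξ ξ hF hFc).aestronglyMeasurable).mpr
      (integrable_norm_twistedOp_sq ξ hξ hF hFc)
  have h3 := h1.sub (h2.const_mul (((2 * ξ / Real.pi) ^ n : ℝ) : ℂ))
  exact (memLp_two_iff_integrable_sq_norm h3.1).mp h3

lemma integral_norm_sub_bargmannProj_sq {ξ : ℝ} (hξ : 0 < ξ) {F : (Fin n → ℂ) → ℂ}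
    (hF : Continuous F) (hFc : HasCompactSupport F) :
    ∫ z, ‖F z - bargmannProj ξ F z‖ ^ 2 = (∫ z, ‖F z‖ ^ 2) - normalizedForm ξ F ξ := by
  set c : ℝ := (2 * ξ / Real.pi) ^ n with hc
  have hcT := continuous_twistedOp ξ ξ hF hFc
  have hn : ∀ z, ‖F z - bargmannProj ξ F z‖ ^ 2 = ‖F z‖ ^ 2 -
      2 * c * (twistedOp ξ ξ F z * conj (F z)).re + c ^ 2 * ‖twistedOp ξ ξ F z‖ ^ 2 := by
    intro z
    rw [bargmannProj, ← hc, ← Complex.normSq_eq_norm_sq, ← Complex.normSq_eq_norm_sq,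
      ← Complex.normSq_eq_norm_sq, Complex.normSq_sub, Complex.normSq_mul, Complex.normSq_ofReal,
      map_mul, Complex.conj_ofReal]
    simp only [Complex.mul_re, Complex.mul_im, Complex.conj_re, Complex.conj_im,
      Complex.ofReal_re, Complex.ofReal_im]
    ring
  have i1 : Integrable fun z => ‖F z‖ ^ 2 := integrable_norm_sq hF hFc
  have i2 : Integrable fun z => twistedOp ξ ξ F z * conj (F z) := by
    refine (hcT.mul (Complex.continuous_conj.comp hF)).integrable_of_hasCompactSupport ?_
    refine HasCompactSupport.intro hFc.isCompact fun z hz => ?_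
    change twistedOp ξ ξ F z * conj (F z) = 0
    rw [image_eq_zero_of_notMem_tsupport hz, map_zero, mul_zero]
  have i3 := integrable_norm_twistedOp_sq ξ hξ hF hFc
  have e2 : ∫ z, (twistedOp ξ ξ F z * conj (F z)).re = (twistedForm ξ ξ F).re := by
    rw [← integral_twistedOp_mul_conj ξ ξ hF hFc]
    exact integral_re i2
  have e3 : c * ∫ z, ‖twistedOp ξ ξ F z‖ ^ 2 = (twistedForm ξ ξ F).re := by
    have h := congrArg Complex.re (integral_norm_twistedOp_sq ξ hξ hF hFc)
    have hc' : ((Real.pi / (2 * (ξ : ℂ))) ^ n : ℂ) = (((Real.pi / (2 * ξ)) ^ n : ℝ) : ℂ) := by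
      push_cast; rfl
    have hξ' : (ξ ^ 2 + ξ ^ 2) / (2 * ξ) = ξ := by field_simp; ring
    rw [hξ', hc', Complex.re_ofReal_mul, Complex.ofReal_re] at h
    rw [h, ← mul_assoc, hc, ← mul_pow]
    have : 2 * ξ / Real.pi * (Real.pi / (2 * ξ)) = 1 := by
      have := Real.pi_ne_zero
      field_simp
    rw [this, one_pow, one_mul]
  simp_rw [hn]
  have i2' : Integrable fun z => (twistedOp ξ ξ F z * conj (F z)).re := i2.re
  have i12 : Integrable fun z => ‖F z‖ ^ 2 - 2 * c * (twistedOp ξ ξ F z * conj (F z)).re :=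
    i1.sub (i2'.const_mul _)
  rw [integral_add i12 (i3.const_mul _), integral_sub i1 (i2'.const_mul _), integral_const_mul,
    integral_const_mul]
  rw [e2, normalizedForm, ← two_mul, ← hc, pow_two c, mul_assoc c, e3]
  ring

end QuadraticForm

section WeakDerivative

variable {n : ℕ}

open ComplexConjugate

/-- `G` is the weak derivative `(∂/∂z̄_j + ξ z_j) F`. -/
def IsWeakDbar (ξ : ℝ) (j : Fin n) (F G : (Fin n → ℂ) → ℂ) : Prop :=
  ∀ ψ : (Fin n → ℂ) → ℂ, ContDiff ℝ ∞ ψ →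
    ∫ z, G z * ψ z = ∫ z, F z * (ξ * z j * ψ z - dbar j ψ z)

lemma contDiff_twistedKernel_right (ξ α : ℝ) (z : Fin n → ℂ) :
    ContDiff ℝ ∞ fun w => twistedKernel ξ α z w := by
  simp_rw [twistedKernel_swap ξ]
  exact contDiff_twistedKernel_left _ _ _

lemma dbar_twistedKernel_right (ξ α : ℝ) (z : Fin n → ℂ) (j : Fin n) (w : Fin n → ℂ) :
    dbar j (fun w => twistedKernel ξ α z w) w =
      (ξ * z j - α * (w j - z j)) * twistedKernel ξ α z w := by
  simp_rw [twistedKernel_swap ξ]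
  rw [dbar_twistedKernel_left]
  push_cast
  ring

lemma IsWeakDbar.integral_mul_kernel {ξ : ℝ} {j : Fin n} {F G : (Fin n → ℂ) → ℂ}
    (h : IsWeakDbar ξ j F G) (α : ℝ) (z : Fin n → ℂ) :
    ∫ w, G w * twistedKernel ξ α z w =
      ∫ w, (α + ξ) * (w j - z j) * twistedKernel ξ α z w * F w := by
  rw [h _ (contDiff_twistedKernel_right ξ α z)]
  refine integral_congr_ae (Eventually.of_forall fun w => ?_)
  simp only [dbar_twistedKernel_right]
  ring

lemma IsWeakDbar.integral_mul_conj_mul_kernel {ξ : ℝ} {j : Fin n} {F G : (Fin n → ℂ) → ℂ}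
    (h : IsWeakDbar ξ j F G) (α : ℝ) (w : Fin n → ℂ) :
    ∫ z, (w j - z j) * twistedKernel ξ α z w * conj (G z) =
      ∫ z, (1 - (α + ξ) * ((z j - w j) * conj (z j - w j))) * twistedKernel ξ α z w *
        conj (F z) := by
  have h1 : ContDiff ℝ ∞ fun z : Fin n → ℂ => conj (w j - z j) := by
    simp only [map_sub]
    exact contDiff_const.sub (contDiff_conj_apply j)
  have h2 := contDiff_twistedKernel_right ξ α w
  have e := congrArg conj (h _ (h1.mul h2))
  rw [← integral_conj, ← integral_conj] at e
  refine (integral_congr_ae (Eventually.of_forall fun z => ?_)).trans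
    (e.trans (integral_congr_ae (Eventually.of_forall fun z => ?_)))
  · simp only [map_mul, Complex.conj_conj, twistedKernel_conj]
    ring
  · simp only
    rw [dbar_mul (h1.differentiable (by simp) z) (h2.differentiable (by simp) z),
      dbar_sub_conj, dbar_twistedKernel_right]
    simp only [map_mul, map_sub, map_add, map_neg, map_one, Complex.conj_conj, twistedKernel_conj,
      Complex.conj_ofReal]
    ring

/-- The form with kernel weighted by `|z_j - w_j|²`. -/
def weightedForm (ξ α : ℝ) (F : (Fin n → ℂ) → ℂ) (j : Fin n) : ℂ :=
  ∫ q : (Fin n → ℂ) × (Fin n → ℂ), ((q.1 j - q.2 j) * conj (q.1 j - q.2 j)) *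
    twistedKernel ξ α q.1 q.2 * (F q.2 * conj (F q.1))

lemma continuous_weight (ξ α : ℝ) (j : Fin n) :
    Continuous fun q : (Fin n → ℂ) × (Fin n → ℂ) =>
      ((q.1 j - q.2 j) * conj (q.1 j - q.2 j)) * twistedKernel ξ α q.1 q.2 := by
  have h : Continuous fun q : (Fin n → ℂ) × (Fin n → ℂ) => q.1 j - q.2 j := by fun_prop
  exact (h.mul (Complex.continuous_conj.comp h)).mul (by fun_prop)

lemma twistedForm_eq_of_isWeakDbar {ξ : ℝ} {j : Fin n} {F G : (Fin n → ℂ) → ℂ}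
    (hF : Continuous F) (hFc : HasCompactSupport F) (hG : Continuous G)
    (hGc : HasCompactSupport G) (h : IsWeakDbar ξ j F G) (α : ℝ) :
    twistedForm ξ α G =
      (α + ξ) * (twistedForm ξ α F - (α + ξ) * weightedForm ξ α F j) := by
  have iG := integrable_mul_mul_conj hG hG hGc hGc
    (c := fun q => twistedKernel ξ α q.1 q.2) (by fun_prop)
  have iFG := integrable_mul_mul_conj hF hG hFc hGc
    (c := fun q => (α + ξ) * (q.2 j - q.1 j) * twistedKernel ξ α q.1 q.2) (by fun_prop)
  have iF := integrable_mul_mul_conj hF hF hFc hFc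
    (c := fun q => twistedKernel ξ α q.1 q.2) (by fun_prop)
  have iN := integrable_mul_mul_conj hF hF hFc hFc (continuous_weight ξ α j)
  have iS := (iF.sub (iN.const_mul (α + ξ : ℂ))).const_mul (α + ξ : ℂ)
  have eR : (α + ξ) * (twistedForm ξ α F - (α + ξ) * weightedForm ξ α F j) =
      ∫ q : (Fin n → ℂ) × (Fin n → ℂ), (α + ξ : ℂ) * (twistedKernel ξ α q.1 q.2 *
        (F q.2 * conj (F q.1)) - (α + ξ) * (((q.1 j - q.2 j) * conj (q.1 j - q.2 j)) *
          twistedKernel ξ α q.1 q.2 * (F q.2 * conj (F q.1)))) := by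
    rw [integral_const_mul, integral_sub iF (iN.const_mul _), integral_const_mul, twistedForm,
      weightedForm]
  rw [eR, twistedForm]
  simp only [Measure.volume_eq_prod] at iG iFG iS ⊢
  rw [integral_prod _ iG]
  refine Eq.trans ?_ (integral_prod_symm _ iS).symm
  refine Eq.trans ?_ ((integral_prod _ iFG).symm.trans ((integral_prod_symm _ iFG).trans ?_))
  · refine integral_congr_ae (Eventually.of_forall fun z => ?_)
    have e := congrArg (· * conj (G z)) (h.integral_mul_kernel α z)
    simp only [← integral_mul_const] at e
    refine Eq.trans (integral_congr_ae (Eventually.of_forall fun w => ?_))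
      (e.trans (integral_congr_ae (Eventually.of_forall fun w => ?_)))
    · simp only; ring
    · simp only; ring
  · refine integral_congr_ae (Eventually.of_forall fun w => ?_)
    have e := congrArg ((α + ξ) * F w * ·) (h.integral_mul_conj_mul_kernel α w)
    simp only [← integral_const_mul] at e
    refine Eq.trans (integral_congr_ae (Eventually.of_forall fun z => ?_))
      (e.trans (integral_congr_ae (Eventually.of_forall fun z => ?_)))
    · simp only; ring
    · simp only [Pi.sub_apply]; ring

lemma hasDerivAt_twistedKernel (ξ α : ℝ) (z w : Fin n → ℂ) :
    HasDerivAt (fun α => twistedKernel ξ α z w) (-nsq (z - w) * twistedKernel ξ α z w) α := by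
  have h : ∀ i ∈ (Finset.univ : Finset (Fin n)), HasDerivAt (fun α : ℝ =>
      (ξ * (z i * conj (w i) - conj (z i) * w i) - α * ((z i - w i) * conj (z i - w i)) : ℂ))
      (0 - 1 * ((z i - w i) * conj (z i - w i))) α := fun i _ =>
    (hasDerivAt_const _ _).sub ((hasDerivAt_id α).ofReal_comp.mul_const _)
  have h2 := (HasDerivAt.fun_sum h).cexp
  refine h2.congr_deriv ?_
  rw [nsq_eq_sum, twistedKernel, mul_comm]
  simp

lemma hasDerivAt_twistedForm (ξ : ℝ) {α : ℝ} (hα : 0 < α) {F : (Fin n → ℂ) → ℂ}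
    (hF : Continuous F) (hFc : HasCompactSupport F) :
    HasDerivAt (fun α => twistedForm ξ α F) (-∑ j, weightedForm ξ α F j) α := by
  have hcF := continuous_mul_conj hF hF
  have hs := hasCompactSupport_mul_conj hFc hFc
  have hn : Continuous fun q : (Fin n → ℂ) × (Fin n → ℂ) => nsq (q.1 - q.2) := by fun_prop
  have hn' : Continuous fun q : (Fin n → ℂ) × (Fin n → ℂ) => (-nsq (q.1 - q.2) : ℂ) :=
    (Complex.continuous_ofReal.comp hn).neg
  have hk : ∀ a : ℝ, Continuous fun q : (Fin n → ℂ) × (Fin n → ℂ) =>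
    twistedKernel ξ a q.1 q.2 := fun a => by fun_prop
  have key := hasDerivAt_integral_of_dominated_loc_of_deriv_le
    (μ := (volume : Measure ((Fin n → ℂ) × (Fin n → ℂ)))) (x₀ := α) (s := Set.Ioi 0)
    (F := fun a q => twistedKernel ξ a q.1 q.2 * (F q.2 * conj (F q.1)))
    (F' := fun a q => -nsq (q.1 - q.2) * twistedKernel ξ a q.1 q.2 * (F q.2 * conj (F q.1)))
    (bound := fun q => ‖(-nsq (q.1 - q.2) : ℂ) * (F q.2 * conj (F q.1))‖)
    (Ioi_mem_nhds hα)
    (Eventually.of_forall fun a => ((hk a).mul hcF).aestronglyMeasurable)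
    (integrable_mul_mul_conj hF hF hFc hFc (hk α))
    ((hn'.mul (hk α)).mul hcF).aestronglyMeasurable
    (Eventually.of_forall fun q a ha => ?_)
    (((hn'.mul hcF).integrable_of_hasCompactSupport hs.mul_left).norm)
    (Eventually.of_forall fun q a _ => (hasDerivAt_twistedKernel ξ a q.1 q.2).mul_const _)
  · refine key.2.congr_deriv ?_
    simp only [weightedForm]
    rw [← integral_finsetSum _ fun j _ =>
      integrable_mul_mul_conj hF hF hFc hFc (continuous_weight ξ α j), ← integral_neg]
    refine integral_congr_ae (Eventually.of_forall fun q => ?_)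
    simp only
    rw [← Finset.sum_mul, ← Finset.sum_mul, nsq_eq_sum]
    simp
  · rw [mul_right_comm, norm_mul]
    exact mul_le_of_le_one_right (norm_nonneg _)
      (norm_twistedKernel_le_one ξ (le_of_lt ha) _ _)

lemma hasDerivAt_normalizedForm {ξ α : ℝ} (hξ : 0 < ξ) (hα : 0 < α) {F : (Fin n → ℂ) → ℂ}
    {G : Fin n → (Fin n → ℂ) → ℂ} (hF : Continuous F) (hFc : HasCompactSupport F)
    (hG : ∀ j, Continuous (G j)) (hGc : ∀ j, HasCompactSupport (G j))
    (h : ∀ j, IsWeakDbar ξ j F (G j)) :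
    HasDerivAt (normalizedForm ξ F) (((α + ξ) ^ 2)⁻¹ * ∑ j, normalizedForm ξ (G j) α) α := by
  have h1 : HasDerivAt (fun a => ((a + ξ) / Real.pi) ^ n)
      (n * ((α + ξ) / Real.pi) ^ (n - 1) * (1 / Real.pi)) α :=
    (((hasDerivAt_id α).add_const ξ).div_const Real.pi).pow n
  have h2 : HasDerivAt (fun a => (twistedForm ξ a F).re) (-∑ j, (weightedForm ξ α F j).re) α := by
    refine HasDerivAt.congr_deriv
      (Complex.reCLM.hasFDerivAt.comp_hasDerivAt α (hasDerivAt_twistedForm ξ hα hF hFc)) ?_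
    simp
  refine (h1.mul h2).congr_deriv ?_
  have e : ∀ j, (twistedForm ξ α (G j)).re =
      (α + ξ) * ((twistedForm ξ α F).re - (α + ξ) * (weightedForm ξ α F j).re) := by
    intro j
    have := congrArg Complex.re
      (twistedForm_eq_of_isWeakDbar hF hFc (hG j) (hGc j) (h j) α)
    rw [this, ← Complex.ofReal_add, Complex.re_ofReal_mul, Complex.sub_re, Complex.re_ofReal_mul]
  simp_rw [normalizedForm, e]
  rw [← Finset.mul_sum, ← Finset.mul_sum, Finset.sum_sub_distrib, ← Finset.mul_sum]
  simp only [Finset.sum_const, Finset.card_univ, Fintype.card_fin, nsmul_eq_mul]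
  have hx : 0 < α + ξ := by linarith
  have hpi := Real.pi_pos
  have hp : (n : ℝ) * ((α + ξ) / Real.pi) ^ (n - 1) * (1 / Real.pi) =
      n * ((α + ξ) / Real.pi) ^ n / (α + ξ) := by
    rcases n with _ | m
    · simp
    · rw [Nat.add_sub_cancel, pow_succ]
      field_simp
  rw [hp]
  field_simp
  ring

end WeakDerivative

section FibreEstimate

variable {n : ℕ}

open ComplexConjugate Topology

lemma integral_comp_add_smul {X : Type*} [NormedAddCommGroup X] [NormedSpace ℝ X]
    (g : (Fin n → ℂ) → X) (z : Fin n → ℂ) {s : ℝ} (hs : 0 < s) :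
    ∫ w, g w = (s ^ 2) ^ n • ∫ y, g (z + s • y) := by
  have h := Measure.integral_comp_smul (volume : Measure (Fin n → ℂ)) (fun y => g (z + y)) s
  have hd : Module.finrank ℝ (Fin n → ℂ) = n * 2 := by
    simp [Module.finrank_pi_fintype, Complex.finrank_real_complex]
  have hp : 0 < s ^ (n * 2) := by positivity
  rw [h, integral_add_left_eq_self, hd, abs_of_pos (inv_pos.mpr hp), smul_smul, ← pow_mul,
    mul_comm 2 n, mul_inv_cancel₀ hp.ne', one_smul]

lemma twistedKernel_rescale (ξ : ℝ) {s : ℝ} (hs : 0 < s) (z y : Fin n → ℂ) :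
    twistedKernel ξ ((s ^ 2)⁻¹) z (z + s • y) = twistedKernel (ξ * s) 1 z (z + y) := by
  have : (s : ℂ) ≠ 0 := by exact_mod_cast hs.ne'
  rw [twistedKernel, twistedKernel]
  congr 1
  refine Finset.sum_congr rfl fun i _ => ?_
  simp only [Pi.add_apply, Pi.smul_apply, Complex.real_smul, map_add, map_mul, map_sub,
    Complex.conj_ofReal]
  push_cast
  field_simp
  ring

lemma normalizedForm_rescale (ξ : ℝ) {s : ℝ} (hs : 0 < s) {F : (Fin n → ℂ) → ℂ}
    (hF : Continuous F) (hFc : HasCompactSupport F) :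
    normalizedForm ξ F ((s ^ 2)⁻¹) = ((1 + ξ * s ^ 2) / Real.pi) ^ n *
      (∫ z, ∫ y, twistedKernel (ξ * s) 1 z (z + y) * (F (z + s • y) * conj (F z))).re := by
  have h := integrable_mul_mul_conj hF hF hFc hFc
    (c := fun q => twistedKernel ξ ((s ^ 2)⁻¹) q.1 q.2) (by fun_prop)
  rw [Measure.volume_eq_prod] at h
  have e : twistedForm ξ ((s ^ 2)⁻¹) F = ((s ^ 2) ^ n : ℝ) *
      ∫ z, ∫ y, twistedKernel (ξ * s) 1 z (z + y) * (F (z + s • y) * conj (F z)) := by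
    rw [twistedForm, Measure.volume_eq_prod, integral_prod _ h, ← integral_const_mul]
    refine integral_congr_ae (Eventually.of_forall fun z => ?_)
    simp only
    rw [integral_comp_add_smul _ z hs]
    simp_rw [twistedKernel_rescale ξ hs]
    rw [Complex.real_smul]
  rw [normalizedForm, e, Complex.re_ofReal_mul, ← mul_assoc, ← mul_pow]
  congr 2
  field_simp

/-- The integrand of `twistedForm` after rescaling around the diagonal. -/
def rescaledIntegrand (ξ : ℝ) (F : (Fin n → ℂ) → ℂ) (s : ℝ) (q : (Fin n → ℂ) × (Fin n → ℂ)) : ℂ :=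
  twistedKernel (ξ * s) 1 q.1 (q.1 + q.2) * (F (q.1 + s • q.2) * conj (F q.1))

lemma continuous_rescaledIntegrand {X : Type*} [TopologicalSpace X] (ξ : ℝ)
    {F : (Fin n → ℂ) → ℂ} (hF : Continuous F) {a : X → ℝ} {b : X → (Fin n → ℂ) × (Fin n → ℂ)}
    (ha : Continuous a) (hb : Continuous b) :
    Continuous fun x => rescaledIntegrand ξ F (a x) (b x) := by
  have h1 : Continuous fun x => F ((b x).1 + a x • (b x).2) := hF.comp (by fun_prop)
  have h2 : Continuous fun x => conj (F (b x).1) :=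
    Complex.continuous_conj.comp (hF.comp (by fun_prop))
  have h3 : Continuous fun x => twistedKernel (ξ * a x) 1 (b x).1 ((b x).1 + (b x).2) := by
    fun_prop
  exact h3.mul (h1.mul h2)

lemma norm_rescaledIntegrand_le (ξ : ℝ) {F : (Fin n → ℂ) → ℂ} {M : ℝ} (hM : ∀ z, ‖F z‖ ≤ M)
    (s : ℝ) (q : (Fin n → ℂ) × (Fin n → ℂ)) :
    ‖rescaledIntegrand ξ F s q‖ ≤ (M * ‖F q.1‖) * Real.exp (-1 * nsq q.2) := by
  have hq : nsq (q.1 - (q.1 + q.2)) = nsq q.2 := by simp [nsq]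
  rw [rescaledIntegrand, norm_mul, norm_mul, norm_twistedKernel, hq, mul_comm, RCLike.norm_conj]
  gcongr
  exact hM _

lemma rescaledIntegrand_zero (ξ : ℝ) (F : (Fin n → ℂ) → ℂ) (q : (Fin n → ℂ) × (Fin n → ℂ)) :
    rescaledIntegrand ξ F 0 q = (((‖F q.1‖ ^ 2) * Real.exp (-1 * nsq q.2) : ℝ) : ℂ) := by
  have hk : twistedKernel 0 1 q.1 (q.1 + q.2) = (Real.exp (-1 * nsq q.2) : ℂ) := by
    rw [cexp_neg_nsq, twistedKernel]
    congr 1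
    refine Finset.sum_congr rfl fun i _ => ?_
    simp
  rw [rescaledIntegrand, mul_zero, zero_smul, add_zero, hk, Complex.mul_conj,
    Complex.normSq_eq_norm_sq, Complex.ofReal_mul, mul_comm]

lemma integrable_rescaledIntegrand (ξ : ℝ) {F : (Fin n → ℂ) → ℂ}
    (hF : Continuous F) (hFc : HasCompactSupport F) :
    (∀ s, Integrable (rescaledIntegrand ξ F s) (volume.prod volume)) ∧
      Continuous fun s => ∫ q, rescaledIntegrand ξ F s q ∂(volume.prod volume) := by
  obtain ⟨M, hM⟩ := hF.bounded_above_of_compact_support hFc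
  have hJ1 : ∀ s, Continuous (rescaledIntegrand ξ F s) := fun s =>
    continuous_rescaledIntegrand ξ hF continuous_const continuous_id
  have hJ2 : ∀ q, Continuous fun s => rescaledIntegrand ξ F s q := fun q =>
    continuous_rescaledIntegrand ξ hF continuous_id continuous_const
  have hJs : ∀ s, AEStronglyMeasurable (rescaledIntegrand ξ F s) (volume.prod volume) := fun s =>
    (hJ1 s).aestronglyMeasurable
  have hb : Integrable (fun q : (Fin n → ℂ) × (Fin n → ℂ) =>
      (M * ‖F q.1‖) * Real.exp (-1 * nsq q.2)) (volume.prod volume) :=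
    ((hF.integrable_of_hasCompactSupport hFc).norm.const_mul M).mul_prod
      (integrable_exp_neg_nsq one_pos)
  have hJb := norm_rescaledIntegrand_le ξ hM
  exact ⟨fun s => hb.mono' (hJs s) (Eventually.of_forall (hJb s)),
    continuous_of_dominated hJs (fun s => Eventually.of_forall (hJb s)) hb
      (Eventually.of_forall hJ2)⟩

lemma integral_rescaledIntegrand_zero (ξ : ℝ) (F : (Fin n → ℂ) → ℂ) :
    (∫ q, rescaledIntegrand ξ F 0 q ∂(volume.prod volume)).re =
      Real.pi ^ n * ∫ z, ‖F z‖ ^ 2 := by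
  have h := integral_prod_mul (μ := (volume : Measure (Fin n → ℂ)))
    (ν := (volume : Measure (Fin n → ℂ))) (fun z => ‖F z‖ ^ 2) (fun y => Real.exp (-1 * nsq y))
  simp_rw [rescaledIntegrand_zero]
  rw [integral_complex_ofReal, Complex.ofReal_re, h, integral_exp_neg_nsq one_pos, mul_comm,
    div_one]

lemma normalizedForm_eq_rescaledIntegrand (ξ : ℝ) {s : ℝ} (hs : 0 < s) {F : (Fin n → ℂ) → ℂ}
    (hF : Continuous F) (hFc : HasCompactSupport F) :
    normalizedForm ξ F ((s ^ 2)⁻¹) = ((1 + ξ * s ^ 2) / Real.pi) ^ n *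
      (∫ q, rescaledIntegrand ξ F s q ∂(volume.prod volume)).re := by
  rw [normalizedForm_rescale ξ hs hF hFc,
    integral_prod _ ((integrable_rescaledIntegrand ξ hF hFc).1 s)]
  simp only [rescaledIntegrand]

lemma tendsto_normalizedForm (ξ : ℝ) {F : (Fin n → ℂ) → ℂ}
    (hF : Continuous F) (hFc : HasCompactSupport F) :
    Tendsto (fun s : ℝ => normalizedForm ξ F ((s ^ 2)⁻¹)) (𝓝[>] 0) (𝓝 (∫ z, ‖F z‖ ^ 2)) := by
  have h1 : Continuous fun s : ℝ => ((1 + ξ * s ^ 2) / Real.pi) ^ n := by fun_prop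
  have hlim := ((h1.mul (Complex.continuous_re.comp
    (integrable_rescaledIntegrand ξ hF hFc).2)).tendsto' 0 (∫ z, ‖F z‖ ^ 2) (by
      simp only [Pi.mul_apply, Function.comp_apply]
      rw [integral_rescaledIntegrand_zero, ← mul_assoc, ← mul_pow]
      simp [Real.pi_ne_zero])).mono_left (nhdsWithin_le_nhds (s := Set.Ioi 0))
  refine hlim.congr' ?_
  filter_upwards [self_mem_nhdsWithin] with s hs
  rw [normalizedForm_eq_rescaledIntegrand ξ hs hF hFc, Pi.mul_apply, Function.comp_apply]

lemma monotoneOn_normalizedForm {ξ : ℝ} (hξ : 0 < ξ) {F : (Fin n → ℂ) → ℂ}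
    {G : Fin n → (Fin n → ℂ) → ℂ} (hF : Continuous F) (hFc : HasCompactSupport F)
    (hG : ∀ j, Continuous (G j)) (hGc : ∀ j, HasCompactSupport (G j))
    (h : ∀ j, IsWeakDbar ξ j F (G j)) : MonotoneOn (normalizedForm ξ F) (Set.Ici ξ) := by
  have hd : ∀ α ∈ Set.Ici ξ, HasDerivAt (normalizedForm ξ F) _ α := fun α hα =>
    hasDerivAt_normalizedForm hξ (hξ.trans_le hα) hF hFc hG hGc h
  refine monotoneOn_of_deriv_nonneg (convex_Ici ξ)
    (fun α hα => (hd α hα).continuousAt.continuousWithinAt)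
    (fun α hα => (hd α (interior_subset hα)).differentiableAt.differentiableWithinAt)
    fun α hα => ?_
  have hα' : ξ ≤ α := interior_subset hα
  rw [(hd α hα').deriv]
  exact mul_nonneg (by positivity)
    (Finset.sum_nonneg fun j _ => normalizedForm_nonneg hξ hα' (hG j) (hGc j))

lemma eventually_le_inv_sq (ξ : ℝ) : ∀ᶠ s : ℝ in 𝓝[>] 0, ξ ≤ (s ^ 2)⁻¹ := by
  have h : Tendsto (fun s : ℝ => (s ^ 2)⁻¹) (𝓝[>] 0) atTop := by
    have := (tendsto_pow_atTop (α := ℝ) two_ne_zero).comp tendsto_inv_nhdsGT_zero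
    refine this.congr fun s => ?_
    simp
  exact h.eventually_ge_atTop ξ

lemma normalizedForm_le {ξ α : ℝ} (hξ : 0 < ξ) (hα : ξ ≤ α) {F : (Fin n → ℂ) → ℂ}
    {G : Fin n → (Fin n → ℂ) → ℂ} (hF : Continuous F) (hFc : HasCompactSupport F)
    (hG : ∀ j, Continuous (G j)) (hGc : ∀ j, HasCompactSupport (G j))
    (h : ∀ j, IsWeakDbar ξ j F (G j)) : normalizedForm ξ F α ≤ ∫ z, ‖F z‖ ^ 2 := by
  refine ge_of_tendsto (tendsto_normalizedForm ξ hF hFc) ?_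
  filter_upwards [eventually_le_inv_sq α] with s hs
  exact monotoneOn_normalizedForm hξ hF hFc hG hGc h hα (hα.trans hs) hs

/-- The `L²` estimate for `∂/∂z̄_j + ξ z_j` on the orthogonal complement of its null space. -/
lemma integral_norm_sub_bargmannProj_sq_le {ξ : ℝ} (hξ : 0 < ξ) {F : (Fin n → ℂ) → ℂ}
    {G : Fin n → (Fin n → ℂ) → ℂ} (hF : Continuous F) (hFc : HasCompactSupport F)
    (hG : ∀ j, Continuous (G j)) (hGc : ∀ j, HasCompactSupport (G j))
    (h : ∀ j, IsWeakDbar ξ j F (G j))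
    (hle : ∀ j α, ξ ≤ α → normalizedForm ξ (G j) α ≤ ∫ z, ‖G j z‖ ^ 2) :
    ∫ z, ‖F z - bargmannProj ξ F z‖ ^ 2 ≤ (1 / (2 * ξ)) * ∑ j, ∫ z, ‖G j z‖ ^ 2 := by
  set M := ∑ j, ∫ z, ‖G j z‖ ^ 2 with hM
  have hM0 : 0 ≤ M := Finset.sum_nonneg fun j _ => integral_nonneg fun z => by positivity
  have hd : ∀ α ∈ Set.Ici ξ, HasDerivAt (fun a => normalizedForm ξ F a + M * (a + ξ)⁻¹)
      (((α + ξ) ^ 2)⁻¹ * ∑ j, normalizedForm ξ (G j) α + M * (-1 / (α + ξ) ^ 2)) α := by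
    intro α hα
    have hα' : ξ ≤ α := hα
    have h1 : HasDerivAt (fun a => (a + ξ)⁻¹) (-1 / (α + ξ) ^ 2) α :=
      ((hasDerivAt_id α).add_const ξ).inv (by simp only [id]; linarith)
    exact (hasDerivAt_normalizedForm hξ (hξ.trans_le hα) hF hFc hG hGc h).add (h1.const_mul M)
  have hanti : AntitoneOn (fun a => normalizedForm ξ F a + M * (a + ξ)⁻¹) (Set.Ici ξ) := by
    refine antitoneOn_of_deriv_nonpos (convex_Ici ξ)
      (fun α hα => (hd α hα).continuousAt.continuousWithinAt)
      (fun α hα => (hd α (interior_subset hα)).differentiableAt.differentiableWithinAt)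
      fun α hα => ?_
    have hα' : ξ ≤ α := interior_subset hα
    rw [(hd α hα').deriv]
    have h1 : ∑ j, normalizedForm ξ (G j) α ≤ M := Finset.sum_le_sum fun j _ => hle j α hα'
    have h2 : 0 ≤ ((α + ξ) ^ 2)⁻¹ := by positivity
    have h3 := mul_le_mul_of_nonneg_left h1 h2
    have h4 : M * (-1 / (α + ξ) ^ 2) = -(((α + ξ) ^ 2)⁻¹ * M) := by ring
    linarith
  have hlim : ∫ z, ‖F z‖ ^ 2 ≤ normalizedForm ξ F ξ + M * (ξ + ξ)⁻¹ := by
    refine le_of_tendsto (tendsto_normalizedForm ξ hF hFc) ?_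
    filter_upwards [eventually_le_inv_sq ξ] with s hs
    have h1 := hanti (Set.mem_Ici.mpr le_rfl) (Set.mem_Ici.mpr hs) hs
    have h2 : 0 ≤ M * ((s ^ 2)⁻¹ + ξ)⁻¹ := by positivity
    simp only at h1
    linarith
  rw [integral_norm_sub_bargmannProj_sq hξ hF hFc]
  have h5 : 1 / (2 * ξ) * M = M * (ξ + ξ)⁻¹ := by rw [two_mul]; ring
  linarith

end FibreEstimate

section Decay

variable {n : ℕ}

open ComplexConjugate Topology

lemma norm_pFourier_le {f : Hgrp n → ℂ} (hf : Continuous f) (hfc : HasCompactSupport f) :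
    ∃ C, ∀ z ξ, ‖pFourier f z ξ‖ ≤ C := by
  obtain ⟨M, hM⟩ := hf.bounded_above_of_compact_support hfc
  have hK : IsCompact (Prod.snd '' tsupport f) := hfc.isCompact.image continuous_snd
  refine ⟨(Real.sqrt (2 * Real.pi))⁻¹ * (M * volume.real (Prod.snd '' tsupport f)), fun z ξ => ?_⟩
  have e : ∫ t, f (z, t) * Complex.exp (-Complex.I * ξ * t) =
      ∫ t in Prod.snd '' tsupport f, f (z, t) * Complex.exp (-Complex.I * ξ * t) := by
    rw [setIntegral_eq_integral_of_forall_compl_eq_zero]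
    intro t ht
    rw [image_eq_zero_of_notMem_tsupport fun h => ht ⟨_, h, rfl⟩, zero_mul]
  rw [pFourier, norm_smul, Real.norm_of_nonneg (by positivity), e]
  gcongr
  refine norm_setIntegral_le_of_norm_le_const hK.measure_lt_top fun t _ => ?_
  have : -Complex.I * ξ * t = ((-(ξ * t) : ℝ) : ℂ) * Complex.I := by push_cast; ring
  rw [norm_mul, this, Complex.norm_exp_ofReal_mul_I, mul_one]
  exact hM _

lemma pFourier_dT {f : Hgrp n → ℂ} (hf : ContDiff ℝ ∞ f) (hfc : HasCompactSupport f)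
    (z : Fin n → ℂ) (ξ : ℝ) : pFourier (dT f) z ξ = Complex.I * ξ * pFourier f z ξ := by
  have hc : ∀ {g : Hgrp n → ℂ}, HasCompactSupport g → HasCompactSupport fun t => g (z, t) :=
    fun {g} hg => HasCompactSupport.intro (hg.isCompact.image continuous_snd) fun t ht =>
      image_eq_zero_of_notMem_tsupport fun h => ht ⟨_, h, rfl⟩
  have hu : ∀ t, HasDerivAt (fun t => f (z, t)) (dT f (z, t)) t := fun t =>
    ((hf.differentiable (by simp)) (z, t)).hasFDerivAt.comp_hasDerivAt t
      ((hasDerivAt_const t z).prodMk (hasDerivAt_id t))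
  have hv : ∀ t : ℝ, HasDerivAt (fun t : ℝ => Complex.exp (-Complex.I * ξ * t))
      (Complex.exp (-Complex.I * ξ * t) * (-Complex.I * ξ)) t := fun t => by
    have h := ((hasDerivAt_id t).ofReal_comp.const_mul (-Complex.I * ξ)).cexp
    simpa using h
  have hf0 : Continuous f := hf.continuous
  have hf1 : Continuous (dT f) := (contDiff_dT hf).continuous
  have h := integral_mul_deriv_eq_deriv_mul_of_integrable (fun t _ => hv t) (fun t _ => hu t)
    ((show Continuous fun t : ℝ => Complex.exp (-Complex.I * ξ * t) * dT f (z, t) by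
      fun_prop).integrable_of_hasCompactSupport (hc (hasCompactSupport_dT hfc)).mul_left)
    ((show Continuous fun t : ℝ => Complex.exp (-Complex.I * ξ * t) * (-Complex.I * ξ) * f (z, t) by
      fun_prop).integrable_of_hasCompactSupport (hc hfc).mul_left)
    ((show Continuous fun t : ℝ => Complex.exp (-Complex.I * ξ * t) * f (z, t) by
      fun_prop).integrable_of_hasCompactSupport (hc hfc).mul_left)
  rw [pFourier, pFourier, mul_smul_comm]
  congr 1
  rw [← integral_const_mul]
  rw [← integral_neg] at h
  convert h using 1
  · simp_rw [mul_comm]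
  · refine integral_congr_ae (Eventually.of_forall fun t => ?_)
    ring

lemma norm_pFourier_le_inv {f : Hgrp n → ℂ} (hf : ContDiff ℝ ∞ f) (hfc : HasCompactSupport f) :
    ∃ C, ∀ z ξ, ‖pFourier f z ξ‖ ≤ C * (1 + ξ ^ 2)⁻¹ := by
  obtain ⟨A, hA⟩ := norm_pFourier_le hf.continuous hfc
  obtain ⟨B, hB⟩ := norm_pFourier_le (contDiff_dT (contDiff_dT hf)).continuous
    (hasCompactSupport_dT (hasCompactSupport_dT hfc))
  refine ⟨A + B, fun z ξ => ?_⟩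
  have h2 := hB z ξ
  rw [pFourier_dT (contDiff_dT hf) (hasCompactSupport_dT hfc), pFourier_dT hf hfc, ← mul_assoc,
    norm_mul, norm_mul, norm_mul, Complex.norm_I, Complex.norm_real, one_mul, ← sq,
    Real.norm_eq_abs, sq_abs] at h2
  rw [← div_eq_mul_inv, le_div_iff₀ (by positivity)]
  linarith [hA z ξ]

lemma continuous_bargmannProj_pFourier {f : Hgrp n → ℂ} (hf : Continuous f)
    (hfc : HasCompactSupport f) : Continuous fun q : (Fin n → ℂ) × ℝ =>
      bargmannProj q.2 (fun z => pFourier f z q.2) q.1 := by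
  have hF := continuous_pFourier hf hfc
  have hF' : Continuous fun p : ((Fin n → ℂ) × ℝ) × (Fin n → ℂ) => pFourier f p.2 p.1.2 :=
    hF.comp (by fun_prop : Continuous fun p : ((Fin n → ℂ) × ℝ) × (Fin n → ℂ) => (p.2, p.1.2))
  have h := continuous_parametric_integral_of_continuous (μ := (volume : Measure (Fin n → ℂ)))
    (f := fun (q : (Fin n → ℂ) × ℝ) (w : Fin n → ℂ) =>
      twistedKernel q.2 q.2 q.1 w * pFourier f w q.2)
    (by
      have : Continuous fun p : ((Fin n → ℂ) × ℝ) × (Fin n → ℂ) =>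
        twistedKernel p.1.2 p.1.2 p.1.1 p.2 := by fun_prop
      exact this.mul hF') (isCompact_fst_tsupport hfc)
  have e : ∀ q : (Fin n → ℂ) × ℝ, twistedOp q.2 q.2 (fun z => pFourier f z q.2) q.1 =
      ∫ w in Prod.fst '' tsupport f, twistedKernel q.2 q.2 q.1 w * pFourier f w q.2 := by
    intro q
    rw [twistedOp, setIntegral_eq_integral_of_forall_compl_eq_zero]
    intro w hw
    rw [pFourier_eq_zero hw, mul_zero]
  simp_rw [bargmannProj, e]
  exact (Complex.continuous_ofReal.comp (by fun_prop)).mul h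

lemma norm_bargmannProj_le {ξ M : ℝ} (hξ : 0 < ξ) {F : (Fin n → ℂ) → ℂ} (hM : ∀ z, ‖F z‖ ≤ M)
    (z : Fin n → ℂ) : ‖bargmannProj ξ F z‖ ≤ 2 ^ n * M := by
  have hi : Integrable fun w => Real.exp (-ξ * nsq (z - w)) :=
    (integrable_exp_neg_nsq hξ).comp_sub_left z
  have h1 : ‖twistedOp ξ ξ F z‖ ≤ (Real.pi / ξ) ^ n * M := by
    refine (norm_integral_le_of_norm_le (hi.mul_const M)
      (Eventually.of_forall fun w => ?_)).trans_eq ?_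
    · rw [norm_mul, norm_twistedKernel]
      gcongr
      exact hM w
    · rw [integral_mul_const, integral_sub_left_eq_self (fun w => Real.exp (-ξ * nsq w)),
        integral_exp_neg_nsq hξ]
  have h2 : (2 * ξ / Real.pi) ^ n * ((Real.pi / ξ) ^ n * M) = 2 ^ n * M := by
    have := Real.pi_ne_zero
    rw [← mul_assoc, ← mul_pow]
    congr 2
    field_simp
  rw [bargmannProj, norm_mul, Complex.norm_real, Real.norm_of_nonneg (by positivity), ← h2]
  gcongr

end Decay

section HighFrequency

variable {n : ℕ}

/-- Synthesis of a function on the Heisenberg group from its frequencies above `T`. -/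
def highFreq (T : ℝ) (R : (Fin n → ℂ) → ℝ → ℂ) (p : Hgrp n) : ℂ :=
  (Real.sqrt (2 * Real.pi))⁻¹ • ∫ ξ in Set.Ioi T, R p.1 ξ * Complex.exp (Complex.I * ξ * p.2)

lemma norm_mul_cexp_I_mul (a : ℂ) (ξ t : ℝ) : ‖a * Complex.exp (Complex.I * ξ * t)‖ = ‖a‖ := by
  have : Complex.I * ξ * t = ((ξ * t : ℝ) : ℂ) * Complex.I := by push_cast; ring
  rw [norm_mul, this, Complex.norm_exp_ofReal_mul_I, mul_one]

variable {T C : ℝ} {R : (Fin n → ℂ) → ℝ → ℂ}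

lemma integrableOn_of_norm_le_inv {u : ℝ → ℂ} (hu : Continuous u)
    (hb : ∀ ξ, T < ξ → ‖u ξ‖ ≤ C * (1 + ξ ^ 2)⁻¹) : IntegrableOn u (Set.Ioi T) :=
  (integrable_inv_one_add_sq.const_mul C).integrableOn.mono' hu.aestronglyMeasurable
    ((ae_restrict_iff' measurableSet_Ioi).2 (Eventually.of_forall hb))

lemma integrableOn_highFreq (hR : Continuous fun q : (Fin n → ℂ) × ℝ => R q.1 q.2)
    (hb : ∀ z ξ, T < ξ → ‖R z ξ‖ ≤ C * (1 + ξ ^ 2)⁻¹) (z : Fin n → ℂ) (t : ℝ) :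
    IntegrableOn (fun ξ : ℝ => R z ξ * Complex.exp (Complex.I * ξ * t)) (Set.Ioi T) := by
  have hz : Continuous (R z) := hR.comp (by fun_prop : Continuous fun ξ : ℝ => (z, ξ))
  refine integrableOn_of_norm_le_inv (C := C) (by fun_prop) fun ξ hξ => ?_
  rw [norm_mul_cexp_I_mul]
  exact hb z ξ hξ

lemma continuous_highFreq (hR : Continuous fun q : (Fin n → ℂ) × ℝ => R q.1 q.2)
    (hb : ∀ z ξ, T < ξ → ‖R z ξ‖ ≤ C * (1 + ξ ^ 2)⁻¹) : Continuous (highFreq T R) := by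
  have h : Continuous fun p : Hgrp n =>
      ∫ ξ in Set.Ioi T, R p.1 ξ * Complex.exp (Complex.I * ξ * p.2) := by
    refine continuous_of_dominated (bound := fun ξ => C * (1 + ξ ^ 2)⁻¹)
      (fun p => (integrableOn_highFreq hR hb p.1 p.2).aestronglyMeasurable)
      (fun p => (ae_restrict_iff' measurableSet_Ioi).2 (Eventually.of_forall fun ξ hξ => ?_))
      (integrable_inv_one_add_sq.const_mul C).integrableOn (Eventually.of_forall fun ξ => ?_)
    · rw [norm_mul_cexp_I_mul]
      exact hb p.1 ξ hξ
    · have : Continuous fun p : Hgrp n => R p.1 ξ :=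
        hR.comp (by fun_prop : Continuous fun p : Hgrp n => (p.1, ξ))
      fun_prop
  exact Continuous.const_smul h (Real.sqrt (2 * Real.pi))⁻¹

lemma highFreq_sub {R' : (Fin n → ℂ) → ℝ → ℂ} {C' : ℝ}
    (hR : Continuous fun q : (Fin n → ℂ) × ℝ => R q.1 q.2)
    (hb : ∀ z ξ, T < ξ → ‖R z ξ‖ ≤ C * (1 + ξ ^ 2)⁻¹)
    (hR' : Continuous fun q : (Fin n → ℂ) × ℝ => R' q.1 q.2)
    (hb' : ∀ z ξ, T < ξ → ‖R' z ξ‖ ≤ C' * (1 + ξ ^ 2)⁻¹) (p : Hgrp n) :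
    highFreq T (fun z ξ => R z ξ - R' z ξ) p = highFreq T R p - highFreq T R' p := by
  simp only [highFreq, sub_mul]
  rw [integral_sub (integrableOn_highFreq hR hb p.1 p.2) (integrableOn_highFreq hR' hb' p.1 p.2),
    smul_sub]

lemma lintegral_enorm_highFreq_sq (hR : Continuous fun q : (Fin n → ℂ) × ℝ => R q.1 q.2)
    (hb : ∀ z ξ, T < ξ → ‖R z ξ‖ ≤ C * (1 + ξ ^ 2)⁻¹) :
    ∫⁻ p, ‖highFreq T R p‖ₑ ^ 2 = ∫⁻ ξ in Set.Ioi T, ∫⁻ z, ‖R z ξ‖ₑ ^ 2 := by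
  have hm : Measurable fun p : Hgrp n => ‖highFreq T R p‖ₑ ^ 2 :=
    (continuous_highFreq hR hb).measurable.enorm.pow_const 2
  have hm' : Measurable fun q : (Fin n → ℂ) × ℝ => ‖R q.1 q.2‖ₑ ^ 2 :=
    hR.measurable.enorm.pow_const 2
  rw [Measure.volume_eq_prod, lintegral_prod _ hm.aemeasurable,
    lintegral_lintegral_swap (μ := volume.restrict (Set.Ioi T)) (ν := volume)
      (f := fun ξ z => ‖R z ξ‖ₑ ^ 2) (hm'.comp measurable_swap).aemeasurable]
  refine lintegral_congr fun z => ?_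
  have hz : Continuous (R z) := hR.comp (by fun_prop : Continuous fun ξ : ℝ => (z, ξ))
  have h1 : IntegrableOn (R z) (Set.Ioi T) := integrableOn_of_norm_le_inv hz (hb z)
  have h2 : MemLp ((Set.Ioi T).indicator (R z)) 2 := by
    rw [memLp_indicator_iff_restrict measurableSet_Ioi]
    have hbd : ∀ᵐ ξ ∂(volume.restrict (Set.Ioi T)), ‖R z ξ‖ ≤ |C| := by
      refine (ae_restrict_iff' measurableSet_Ioi).2 (Eventually.of_forall fun ξ hξ => ?_)
      refine (hb z ξ hξ).trans ((mul_le_mul_of_nonneg_right (le_abs_self C) (by positivity)).trans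
        (mul_le_of_le_one_right (abs_nonneg C) (inv_le_one_of_one_le₀ ?_)))
      nlinarith [sq_nonneg ξ]
    refine (memLp_two_iff_integrable_sq_norm hz.aestronglyMeasurable).2
      ((h1.norm.const_mul |C|).mono' (hz.norm.pow 2).aestronglyMeasurable ?_)
    filter_upwards [hbd] with ξ hξ
    rw [Real.norm_of_nonneg (by positivity), sq]
    gcongr
  have h := lintegral_enorm_inverse_sq (h1.integrable_indicator measurableSet_Ioi) h2
  have e1 : ∀ ξ, ‖(Set.Ioi T).indicator (R z) ξ‖ₑ ^ 2 =
      (Set.Ioi T).indicator (fun ξ => ‖R z ξ‖ₑ ^ 2) ξ := fun ξ => by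
    by_cases hξ : ξ ∈ Set.Ioi T <;> simp [hξ]
  have e2 : ∀ t ξ : ℝ, (Set.Ioi T).indicator (R z) ξ * Complex.exp (Complex.I * ξ * t) =
      (Set.Ioi T).indicator (fun ξ : ℝ => R z ξ * Complex.exp (Complex.I * ξ * t)) ξ :=
    fun t ξ => by
      by_cases hξ : ξ ∈ Set.Ioi T <;> simp [hξ]
  simp_rw [e1, e2, integral_indicator measurableSet_Ioi] at h
  rw [lintegral_indicator measurableSet_Ioi] at h
  exact h

lemma integral_bargmannProj_mul_Lbar (ξ : ℝ) {F : (Fin n → ℂ) → ℂ} (hF : Continuous F)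
    (hFc : HasCompactSupport F) (j : Fin n) {φ : Hgrp n → ℂ} (hφ : ContDiff ℝ ∞ φ)
    (hφc : HasCompactSupport φ) :
    ∫ p : Hgrp n, bargmannProj ξ F p.1 * Complex.exp (Complex.I * ξ * p.2) * Lbar j φ p = 0 := by
  have hL := (contDiff_Lbar hφ j).continuous
  have hLc := hasCompactSupport_Lbar hφc j
  have hi : Integrable (fun q : Hgrp n × (Fin n → ℂ) =>
      Lbar j φ q.1 * (Complex.exp (Complex.I * ξ * q.1.2) * twistedKernel ξ ξ q.1.1 q.2) * F q.2)
      (volume.prod volume) := by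
    refine Continuous.integrable_of_hasCompactSupport (by fun_prop) ?_
    refine HasCompactSupport.intro (hLc.isCompact.prod hFc.isCompact) fun q hq => ?_
    rw [Set.mem_prod, not_and_or] at hq
    rcases hq with hq | hq
    · simp [image_eq_zero_of_notMem_tsupport hq]
    · simp [image_eq_zero_of_notMem_tsupport hq]
  have h0 : ∀ w, ∫ p : Hgrp n,
      Lbar j φ p * (Complex.exp (Complex.I * ξ * p.2) * twistedKernel ξ ξ p.1 w) = 0 := by
    intro w
    have hψ := contDiff_twistedKernel_left ξ ξ w
    have h := integral_mul_Lbar_eq_neg hφ (contDiff_exp_mul_comp_fst ξ hψ) hφc j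
    simp_rw [Lbar_exp_mul ξ hψ, dbar_twistedKernel_left] at h
    rw [← neg_eq_zero, ← h]
    refine integral_eq_zero_of_ae (Eventually.of_forall fun p => ?_)
    simp only [Pi.zero_apply]
    ring
  have e : ∀ p : Hgrp n, bargmannProj ξ F p.1 * Complex.exp (Complex.I * ξ * p.2) * Lbar j φ p =
      (((2 * ξ / Real.pi) ^ n : ℝ) : ℂ) * ∫ w, Lbar j φ p *
        (Complex.exp (Complex.I * ξ * p.2) * twistedKernel ξ ξ p.1 w) * F w := by
    intro p
    simp_rw [mul_assoc (Lbar j φ p), mul_assoc (Complex.exp _)]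
    rw [integral_const_mul, integral_const_mul, bargmannProj, twistedOp]
    ring
  simp_rw [e]
  rw [integral_const_mul, integral_integral_swap hi]
  simp_rw [integral_mul_const, h0]
  simp

lemma isCRfun_highFreq_bargmannProj {f : Hgrp n → ℂ} (hf : ContDiff ℝ ∞ f)
    (hfc : HasCompactSupport f)
    (hb : ∀ z ξ, T < ξ → ‖bargmannProj ξ (fun w => pFourier f w ξ) z‖ ≤ C * (1 + ξ ^ 2)⁻¹) :
    IsCRfun (highFreq T fun z ξ => bargmannProj ξ (fun w => pFourier f w ξ) z) := by
  intro j φ hφ hφc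
  have hL := (contDiff_Lbar hφ j).continuous
  have hLc := hasCompactSupport_Lbar hφc j
  have hH := continuous_bargmannProj_pFourier hf.continuous hfc
  have hF := continuous_pFourier hf.continuous hfc
  have hc : Continuous fun q : Hgrp n × ℝ => bargmannProj q.2 (fun w => pFourier f w q.2) q.1.1 *
      Complex.exp (Complex.I * q.2 * q.1.2) * Lbar j φ q.1 := by
    have := hH.comp (by fun_prop : Continuous fun q : Hgrp n × ℝ => (q.1.1, q.2))
    simp only [Function.comp_def] at this
    fun_prop
  have hi : Integrable (fun q : Hgrp n × ℝ => bargmannProj q.2 (fun w => pFourier f w q.2) q.1.1 *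
      Complex.exp (Complex.I * q.2 * q.1.2) * Lbar j φ q.1)
      (volume.prod (volume.restrict (Set.Ioi T))) := by
    refine Integrable.mono' (g := fun q => ‖Lbar j φ q.1‖ * (C * (1 + q.2 ^ 2)⁻¹))
      ((hL.integrable_of_hasCompactSupport hLc).norm.mul_prod
        (integrable_inv_one_add_sq.const_mul C).integrableOn) hc.aestronglyMeasurable ?_
    have : ∀ᵐ q ∂((volume : Measure (Hgrp n)).prod (volume.restrict (Set.Ioi T))), T < q.2 :=
      Measure.quasiMeasurePreserving_snd.ae
        ((ae_restrict_iff' measurableSet_Ioi).2 (Eventually.of_forall fun ξ hξ => hξ))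
    filter_upwards [this] with q hq
    rw [norm_mul, norm_mul_cexp_I_mul, mul_comm]
    gcongr
    exact hb _ _ hq
  simp_rw [highFreq, smul_mul_assoc, ← integral_mul_const]
  rw [integral_smul, integral_integral_swap hi]
  have h0 : ∀ ξ, ∫ p : Hgrp n, bargmannProj ξ (fun w => pFourier f w ξ) p.1 *
      Complex.exp (Complex.I * ξ * p.2) * Lbar j φ p = 0 := fun ξ =>
    integral_bargmannProj_mul_Lbar ξ
      (hF.comp (by fun_prop : Continuous fun w : Fin n → ℂ => (w, ξ)))
      (hasCompactSupport_pFourier hfc ξ) j hφ hφc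
  simp_rw [h0]
  simp

end HighFrequency

section Estimate

variable {n : ℕ}

lemma lintegral_enorm_sq_eq_ofReal {X : Type*} [MeasurableSpace X] {μ : Measure X} {u : X → ℂ}
    (hu : Integrable (fun x => ‖u x‖ ^ 2) μ) :
    ∫⁻ x, ‖u x‖ₑ ^ 2 ∂μ = ENNReal.ofReal (∫ x, ‖u x‖ ^ 2 ∂μ) := by
  rw [ofReal_integral_eq_lintegral_ofReal hu (Eventually.of_forall fun x => by positivity)]
  simp_rw [ENNReal.ofReal_pow (norm_nonneg _), ofReal_norm]

lemma continuous_pFourier_left {f : Hgrp n → ℂ} (hf : Continuous f) (hfc : HasCompactSupport f)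
    (ξ : ℝ) : Continuous fun z => pFourier f z ξ :=
  (continuous_pFourier hf hfc).comp (by fun_prop : Continuous fun z : Fin n → ℂ => (z, ξ))

lemma lintegral_enorm_pFourier_sub_bargmannProj_sq_le {f : Hgrp n → ℂ} (hf : ContDiff ℝ ∞ f)
    (hfc : HasCompactSupport f) {ξ : ℝ} (hξ : 0 < ξ) :
    ∫⁻ z, ‖pFourier f z ξ - bargmannProj ξ (fun w => pFourier f w ξ) z‖ₑ ^ 2 ≤
      ENNReal.ofReal (1 / (2 * ξ)) * ∑ j, ∫⁻ z, ‖pFourier (Lbar j f) z ξ‖ₑ ^ 2 := by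
  have hc : ∀ {g : Hgrp n → ℂ}, ContDiff ℝ ∞ g → HasCompactSupport g →
      Continuous fun z => pFourier g z ξ := fun hg hgc =>
    continuous_pFourier_left hg.continuous hgc ξ
  have hle : ∀ j α, ξ ≤ α → normalizedForm ξ (fun z => pFourier (Lbar j f) z ξ) α ≤
      ∫ z, ‖pFourier (Lbar j f) z ξ‖ ^ 2 := fun j α hα =>
    normalizedForm_le hξ hα (hc (contDiff_Lbar hf j) (hasCompactSupport_Lbar hfc j))
      (hasCompactSupport_pFourier (hasCompactSupport_Lbar hfc j) ξ)
      (fun k => hc (contDiff_Lbar (contDiff_Lbar hf j) k)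
        (hasCompactSupport_Lbar (hasCompactSupport_Lbar hfc j) k))
      (fun k => hasCompactSupport_pFourier
        (hasCompactSupport_Lbar (hasCompactSupport_Lbar hfc j) k) ξ)
      (fun k ψ hψ => integral_pFourier_Lbar_mul (contDiff_Lbar hf j)
        (hasCompactSupport_Lbar hfc j) hψ k ξ)
  have h := integral_norm_sub_bargmannProj_sq_le hξ (hc hf hfc) (hasCompactSupport_pFourier hfc ξ)
    (fun j => hc (contDiff_Lbar hf j) (hasCompactSupport_Lbar hfc j))
    (fun j => hasCompactSupport_pFourier (hasCompactSupport_Lbar hfc j) ξ)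
    (fun j ψ hψ => integral_pFourier_Lbar_mul hf hfc hψ j ξ) hle
  have hG : ∀ j, ∫⁻ z, ‖pFourier (Lbar j f) z ξ‖ₑ ^ 2 =
      ENNReal.ofReal (∫ z, ‖pFourier (Lbar j f) z ξ‖ ^ 2) := fun j =>
    lintegral_enorm_sq_eq_ofReal (integrable_norm_sq
      (hc (contDiff_Lbar hf j) (hasCompactSupport_Lbar hfc j))
      (hasCompactSupport_pFourier (hasCompactSupport_Lbar hfc j) ξ))
  simp_rw [hG]
  rw [lintegral_enorm_sq_eq_ofReal (integrable_norm_sub_bargmannProj_sq hξ (hc hf hfc)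
      (hasCompactSupport_pFourier hfc ξ)),
    ← ENNReal.ofReal_sum_of_nonneg fun j _ => integral_nonneg fun z => by positivity,
    ← ENNReal.ofReal_mul (by positivity)]
  exact ENNReal.ofReal_le_ofReal h

/-- Plancherel's theorem for the partial Fourier transform. -/
lemma lintegral_enorm_pFourier_sq {f : Hgrp n → ℂ} (hf : Continuous f)
    (hfc : HasCompactSupport f) :
    ∫⁻ ξ, ∫⁻ z, ‖pFourier f z ξ‖ₑ ^ 2 = ∫⁻ p, ‖f p‖ₑ ^ 2 := by
  have hm : Measurable fun p : Hgrp n => ‖f p‖ₑ ^ 2 := hf.measurable.enorm.pow_const 2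
  have hm' : Measurable fun q : (Fin n → ℂ) × ℝ => ‖pFourier f q.1 q.2‖ₑ ^ 2 :=
    (continuous_pFourier hf hfc).measurable.enorm.pow_const 2
  rw [Measure.volume_eq_prod, lintegral_prod _ hm.aemeasurable,
    lintegral_lintegral_swap (f := fun ξ z => ‖pFourier f z ξ‖ₑ ^ 2)
      (hm'.comp measurable_swap).aemeasurable]
  refine lintegral_congr fun z => ?_
  have hz : Continuous fun t : ℝ => f (z, t) := by fun_prop
  have hzc : HasCompactSupport fun t : ℝ => f (z, t) :=
    HasCompactSupport.intro (hfc.isCompact.image continuous_snd) fun t ht =>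
      image_eq_zero_of_notMem_tsupport fun h => ht ⟨_, h, rfl⟩
  simp_rw [pFourier_eq]
  exact lintegral_enorm_unitaryFourier_sq (hz.integrable_of_hasCompactSupport hzc)
    (hz.memLp_of_hasCompactSupport hzc)

lemma lintegral_enorm_highFreq_sub_bargmannProj_sq_le {T C : ℝ} (hT : 0 < T) {f : Hgrp n → ℂ}
    (hf : ContDiff ℝ ∞ f) (hfc : HasCompactSupport f)
    (hb : ∀ z ξ, T < ξ → ‖pFourier f z ξ - bargmannProj ξ (fun w => pFourier f w ξ) z‖ ≤
      C * (1 + ξ ^ 2)⁻¹) :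
    ∫⁻ p, ‖highFreq T (fun z ξ => pFourier f z ξ -
        bargmannProj ξ (fun w => pFourier f w ξ) z) p‖ₑ ^ 2 ≤
      ENNReal.ofReal (1 / (2 * T)) * ∑ j, ∫⁻ p, ‖Lbar j f p‖ₑ ^ 2 := by
  have hm : ∀ j, Measurable fun ξ => ∫⁻ z, ‖pFourier (Lbar j f) z ξ‖ₑ ^ 2 := fun j => by
    have h : Measurable fun q : (Fin n → ℂ) × ℝ => ‖pFourier (Lbar j f) q.1 q.2‖ₑ ^ 2 :=
      (continuous_pFourier (contDiff_Lbar hf j).continuous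
        (hasCompactSupport_Lbar hfc j)).measurable.enorm.pow_const 2
    exact h.lintegral_prod_left'
  rw [lintegral_enorm_highFreq_sq ((continuous_pFourier hf.continuous hfc).sub
    (continuous_bargmannProj_pFourier hf.continuous hfc)) hb]
  calc _ ≤ ∫⁻ ξ in Set.Ioi T, ENNReal.ofReal (1 / (2 * T)) *
        ∑ j, ∫⁻ z, ‖pFourier (Lbar j f) z ξ‖ₑ ^ 2 := by
        refine setLIntegral_mono' measurableSet_Ioi fun ξ hξ => ?_
        have hξ' : T < ξ := hξ
        refine (lintegral_enorm_pFourier_sub_bargmannProj_sq_le hf hfc (hT.trans hξ')).trans ?_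
        gcongr
    _ ≤ ∫⁻ ξ, ENNReal.ofReal (1 / (2 * T)) *
        ∑ j, ∫⁻ z, ‖pFourier (Lbar j f) z ξ‖ₑ ^ 2 := setLIntegral_le_lintegral _ _
    _ = _ := by
        rw [lintegral_const_mul _ (Finset.measurable_fun_sum _ fun j _ => hm j),
          lintegral_finsetSum _ fun j _ => hm j]
        simp_rw [fun j => lintegral_enorm_pFourier_sq (contDiff_Lbar hf j).continuous
          (hasCompactSupport_Lbar hfc j)]

lemma sub_lowFreq_eq_highFreq {T : ℝ} {f : Hgrp n → ℂ} (hf : ContDiff ℝ ∞ f)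
    (hfc : HasCompactSupport f) (p : Hgrp n) :
    f p - (Real.sqrt (2 * Real.pi))⁻¹ •
        ∫ ξ in Set.Iic T, pFourier f p.1 ξ * Complex.exp (Complex.I * ξ * p.2) =
      highFreq T (pFourier f) p := by
  obtain ⟨C, hC⟩ := norm_pFourier_le_inv hf hfc
  have hF := continuous_pFourier hf.continuous hfc
  have hz : Continuous fun t : ℝ => f (p.1, t) := hf.continuous.comp (by fun_prop)
  have hzc : HasCompactSupport fun t : ℝ => f (p.1, t) :=
    HasCompactSupport.intro (hfc.isCompact.image continuous_snd) fun t ht =>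
      image_eq_zero_of_notMem_tsupport fun h => ht ⟨_, h, rfl⟩
  have hFz : Continuous fun ξ => pFourier f p.1 ξ :=
    hF.comp (by fun_prop : Continuous fun ξ : ℝ => (p.1, ξ))
  have hi : Integrable fun ξ => pFourier f p.1 ξ :=
    (integrable_inv_one_add_sq.const_mul C).mono' hFz.aestronglyMeasurable
      (Eventually.of_forall fun ξ => hC p.1 ξ)
  have hi' : Integrable fun ξ : ℝ => pFourier f p.1 ξ * Complex.exp (Complex.I * ξ * p.2) := by
    refine hi.norm.mono' (by fun_prop) (Eventually.of_forall fun ξ => ?_)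
    rw [norm_mul_cexp_I_mul]
  have h := unitaryFourier_inversion hz (hz.integrable_of_hasCompactSupport hzc)
    (by simpa only [pFourier_eq] using hi) p.2
  simp_rw [← pFourier_eq] at h
  rw [← intervalIntegral.integral_Iic_add_Ioi (b := T) hi'.integrableOn hi'.integrableOn,
    smul_add] at h
  rw [highFreq, sub_eq_iff_eq_add, add_comm]
  exact h

lemma integral_norm_sq_eq_norm_sq {X : Type*} [MeasurableSpace X] {μ : Measure X}
    (g : Lp ℂ 2 μ) : ∫ x, ‖g x‖ ^ 2 ∂μ = ‖g‖ ^ 2 := by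
  have h := L2.inner_def (𝕜 := ℂ) g g
  simp_rw [inner_self_eq_norm_sq_to_K] at h
  have h' : ((‖g‖ ^ 2 : ℝ) : ℂ) = ((∫ x, ‖g x‖ ^ 2 ∂μ : ℝ) : ℂ) := by
    rw [← integral_complex_ofReal]
    push_cast
    exact h
  exact_mod_cast h'.symm

end Estimate

section Conclusion

variable {n : ℕ}

/-- The part of `f` above frequency `T` is within the claimed distance of a CR function. -/
lemma exists_isCRfun_norm_sub_sq_le {T : ℝ} (hT : 0 < T) {f : Hgrp n → ℂ} (hf : ContDiff ℝ ∞ f)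
    (hfc : HasCompactSupport f) (g : Lp ℂ 2 (volume : Measure (Hgrp n)))
    (hg : ⇑g =ᵐ[volume] highFreq T (pFourier f)) :
    ∃ h : Lp ℂ 2 (volume : Measure (Hgrp n)), IsCRfun ⇑h ∧
      ‖g - h‖ ^ 2 ≤ (1 / (2 * T)) * ∑ j, ∫ p, ‖Lbar j f p‖ ^ 2 := by
  obtain ⟨C, hC⟩ := norm_pFourier_le_inv hf hfc
  have hbF : ∀ z ξ, T < ξ → ‖pFourier f z ξ‖ ≤ C * (1 + ξ ^ 2)⁻¹ := fun z ξ _ => hC z ξ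
  have hbH : ∀ z ξ, T < ξ → ‖bargmannProj ξ (fun w => pFourier f w ξ) z‖ ≤
      2 ^ n * C * (1 + ξ ^ 2)⁻¹ := fun z ξ hξ => by
    rw [mul_assoc]
    exact norm_bargmannProj_le (hT.trans hξ) (fun w => hC w ξ) z
  have hF := continuous_pFourier hf.continuous hfc
  have hH := continuous_bargmannProj_pFourier hf.continuous hfc
  have hR : Continuous fun q : (Fin n → ℂ) × ℝ =>
      pFourier f q.1 q.2 - bargmannProj q.2 (fun w => pFourier f w q.2) q.1 := hF.sub hH
  have hbR : ∀ z ξ, T < ξ → ‖pFourier f z ξ - bargmannProj ξ (fun w => pFourier f w ξ) z‖ ≤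
      (C + 2 ^ n * C) * (1 + ξ ^ 2)⁻¹ := fun z ξ hξ => by
    rw [add_mul]
    exact (norm_sub_le _ _).trans (add_le_add (hbF z ξ hξ) (hbH z ξ hξ))
  have hL : ∀ j, ∫⁻ p, ‖Lbar j f p‖ₑ ^ 2 = ENNReal.ofReal (∫ p, ‖Lbar j f p‖ ^ 2) := fun j =>
    lintegral_enorm_sq_eq_ofReal
      (((contDiff_Lbar hf j).continuous.memLp_of_hasCompactSupport
        (hasCompactSupport_Lbar hfc j)).integrable_norm_pow two_ne_zero)
  have hle := lintegral_enorm_highFreq_sub_bargmannProj_sq_le hT hf hfc hbR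
  simp_rw [hL] at hle
  rw [← ENNReal.ofReal_sum_of_nonneg fun j _ => integral_nonneg fun z => by positivity,
    ← ENNReal.ofReal_mul (by positivity)] at hle
  set d := highFreq T fun z ξ => pFourier f z ξ - bargmannProj ξ (fun w => pFourier f w ξ) z
    with hd
  have hdm : AEStronglyMeasurable d volume := (continuous_highFreq hR hbR).aestronglyMeasurable
  have hdi : Integrable fun p => ‖d p‖ ^ 2 := by
    refine ⟨hdm.norm.pow 2, ?_⟩
    refine lt_of_eq_of_lt ?_ (hle.trans_lt ENNReal.ofReal_lt_top)
    refine lintegral_congr fun p => ?_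
    simp
  have hd2 : MemLp d 2 volume := (memLp_two_iff_integrable_sq_norm hdm).2 hdi
  refine ⟨g - hd2.toLp d, ?_, ?_⟩
  · intro j φ hφ hφc
    rw [← isCRfun_highFreq_bargmannProj hf hfc hbH j φ hφ hφc]
    refine integral_congr_ae ?_
    filter_upwards [Lp.coeFn_sub g (hd2.toLp d), hd2.coeFn_toLp, hg] with p h1 h2 h3
    rw [h1, Pi.sub_apply, h2, h3, hd, highFreq_sub hF hbF hH hbH, sub_sub_cancel]
  · rw [sub_sub_cancel, ← integral_norm_sq_eq_norm_sq]
    have e : ∫ p, ‖hd2.toLp d p‖ ^ 2 = ∫ p, ‖d p‖ ^ 2 :=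
      integral_congr_ae (hd2.coeFn_toLp.mono fun p hp => by simp only [hp])
    rw [e]
    rw [lintegral_enorm_sq_eq_ofReal hdi] at hle
    refine (ENNReal.ofReal_le_ofReal_iff ?_).1 hle
    exact mul_nonneg (by positivity)
      (Finset.sum_nonneg fun j _ => integral_nonneg fun z => by positivity)

end Conclusion

/-- high-frequency estimate
∫ |P_{>T}f − Sₙ(P_{>T}f)|² dσ ≤ (2/T) ∫ Σⱼ |L̄ⱼf|² dσ for f ∈ C_c^∞, T > 0.
Here S is the orthogonal projection of L²(σ) onto CR²(ℍⁿ,σ), P is the frequency cutoff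
P_{≤T} (determined on the dense set of Schwartz functions), and P_{>T} = I − P. -/
theorem high_frequency_estimate (n : ℕ) (T : ℝ) (hT : 0 < T)
    (S P : Lp ℂ 2 (volume : Measure (Hgrp n)) →L[ℂ] Lp ℂ 2 (volume : Measure (Hgrp n)))
    (hSmem : ∀ f, IsCRfun (⇑(S f)))
    (hSorth : ∀ (f g : Lp ℂ 2 (volume : Measure (Hgrp n))), IsCRfun (⇑g) →
      inner (𝕜 := ℂ) (f - S f) g = 0)
    (hP : ∀ (f : SchwartzMap (Hgrp n) ℂ) (fL : Lp ℂ 2 (volume : Measure (Hgrp n))),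
      (⇑fL : Hgrp n → ℂ) =ᵐ[volume] ⇑f →
      (⇑(P fL) : Hgrp n → ℂ) =ᵐ[volume] fun p : Hgrp n =>
        (Real.sqrt (2 * Real.pi))⁻¹ •
          ∫ ξ in Set.Iic T, pFourier (⇑f) p.1 ξ * Complex.exp (Complex.I * ξ * p.2))
    (f : Hgrp n → ℂ) (hf : ContDiff ℝ ∞ f) (hfc : HasCompactSupport f)
    (fL : Lp ℂ 2 (volume : Measure (Hgrp n))) (hfL : (⇑fL : Hgrp n → ℂ) =ᵐ[volume] f) :
    ∫ p : Hgrp n, ‖(⇑((fL - P fL) - S (fL - P fL)) : Hgrp n → ℂ) p‖ ^ 2 ∂volume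
      ≤ (2 / T) * ∫ p : Hgrp n, (∑ j, ‖Lbar j f p‖ ^ 2) ∂volume := by
  set g := fL - P fL with hgdef
  have hg : ⇑g =ᵐ[volume] highFreq T (pFourier f) := by
    filter_upwards [Lp.coeFn_sub fL (P fL), hfL, hP (hfc.toSchwartzMap hf) fL hfL] with p h1 h2 h3
    rw [h1, Pi.sub_apply, h2, h3]
    exact sub_lowFreq_eq_highFreq hf hfc p
  obtain ⟨h, hCR, hle⟩ := exists_isCRfun_norm_sub_sq_le hT hf hfc g hg
  have hL : ∀ j, Integrable fun p => ‖Lbar j f p‖ ^ 2 := fun j =>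
    ((contDiff_Lbar hf j).continuous.memLp_of_hasCompactSupport
      (hasCompactSupport_Lbar hfc j)).integrable_norm_pow two_ne_zero
  have horth : inner ℂ (g - S g) (S g - h) = 0 := by
    rw [inner_sub_right, hSorth g (S g) (hSmem g), hSorth g h hCR, sub_zero]
  have hpyth : ‖g - S g‖ ^ 2 ≤ ‖g - h‖ ^ 2 := by
    have e := norm_add_sq_eq_norm_sq_add_norm_sq_of_inner_eq_zero (g - S g) (S g - h) horth
    rw [sub_add_sub_cancel] at e
    nlinarith [sq_nonneg ‖S g - h‖]
  rw [integral_norm_sq_eq_norm_sq, integral_finsetSum _ fun j _ => hL j]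
  refine hpyth.trans (hle.trans ?_)
  refine mul_le_mul_of_nonneg_right ?_
    (Finset.sum_nonneg fun j _ => integral_nonneg fun p => by positivity)
  rw [div_le_div_iff₀ (by positivity) hT]
  linarith
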